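/- arXiv:0802.1853 — 12 statements merged into one kernel-verified Lean document; each statement's English description precedes it below -/
import Mathlib

section
/- Let G be a finite group and H a subgroup of G. If A ⊆ H is a self-linked subset of the group H (i.e. A·A⁻¹ = H) and B is a subset of the left coset space G/H that is self-linked for the natural G-action (i.e. B ∩ gB ≠ ∅ for all g ∈ G), then there exists a self-linked subset C ⊆ G with |C| ≤ |A|·|B|. Consequently sl(G) ≤ sl(H)·sl(G/H). -/
open Pointwise

/-- A subset `A` of a group `G` is *self-linked* if `A ∩ xA ≠ ∅` for every `x ∈ G`. -/
def IsSelfLinked {G : Type*} [Group G] (A : Set G) : Prop :=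
  ∀ x : G, (A ∩ x • A).Nonempty

/-- If `H` is a subgroup of a finite group `G`, `A ⊆ H` is self-linked in the group `H`
(i.e. `A·A⁻¹ = H`) and `B ⊆ G/H` is self-linked for the natural `G`-action on the left
coset space `G/H`, then there is a self-linked subset `C ⊆ G` with `|C| ≤ |A|·|B|`.
Consequently `sl(G) ≤ sl(H)·sl(G/H)`. -/
theorem stmt1 {G : Type*} [Group G] [Finite G] (H : Subgroup G)
    (A : Set G) (hAH : A ⊆ (H : Set G)) (hA : A * A⁻¹ = (H : Set G))
    (B : Set (G ⧸ H)) (hB : ∀ g : G, (B ∩ g • B).Nonempty) :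
    ∃ C : Set G, IsSelfLinked C ∧ C.ncard ≤ A.ncard * B.ncard := by
  have hx (x : G) : ∃ b ∈ B, ∃ b' ∈ B, ∃ a ∈ A, ∃ a' ∈ A,
      x * (b'.out * a') = b.out * a := by
    obtain ⟨_, hb, b', hb', rfl⟩ := hB x
    have h : (x • b').out⁻¹ * (x * b'.out) ∈ (H : Set G) := by
      refine QuotientGroup.eq.mp ?_
      rw [QuotientGroup.out_eq', ← smul_eq_mul x, ← MulAction.Quotient.smul_coe,
        QuotientGroup.out_eq']
    rw [← hA] at h
    obtain ⟨a, ha, a', ha', h⟩ := h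
    refine ⟨_, hb, b', hb', a, ha, a'⁻¹, ha', ?_⟩
    have h : a * a' = (x • b').out⁻¹ * (x * b'.out) := h
    rw [eq_mul_inv_of_mul_eq h]
    group
  refine ⟨(fun p : G × (G ⧸ H) => p.2.out * p.1) '' A ×ˢ B, fun x => ?_, ?_⟩
  · obtain ⟨b, hb, b', hb', a, ha, a', ha', h⟩ := hx x
    exact ⟨b.out * a, ⟨(a, b), ⟨ha, hb⟩, rfl⟩, b'.out * a', ⟨(a', b'), ⟨ha', hb'⟩, rfl⟩, h⟩
  · exact (Set.ncard_image_le (Set.toFinite _)).trans_eq Set.ncard_prod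
end

section
/- Let G be a finite group and H a subgroup of G. Then there exists a self-linked subset A ⊆ G with |A| ≤ |H| + [G:H] − 1; in particular the smallest cardinality sl(G) of a self-linked subset of G satisfies sl(G) < |H| + [G:H]. -/
open Pointwise

/-- For any subgroup `H` of a finite group `G` there is a self-linked subset `A ⊆ G`
with `|A| ≤ |H| + [G:H] − 1`; in particular `sl(G) < |H| + [G:H]`. -/
theorem stmt2 {G : Type*} [Group G] [Finite G] (H : Subgroup G) :
    ∃ A : Set G, IsSelfLinked A ∧
      A.ncard ≤ Nat.card H + H.index - 1 ∧ A.ncard < Nat.card H + H.index := by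
  set T : Set G := Quotient.out '' ({((1 : G) : G ⧸ H)}ᶜ : Set (G ⧸ H))
  have hT : T.ncard ≤ H.index - 1 := by
    refine (Set.ncard_image_le (Set.toFinite _)).trans ?_
    rw [Set.ncard_compl, Set.ncard_singleton]
    exact le_rfl
  have hcard : ((H : Set G) ∪ T).ncard ≤ Nat.card H + (H.index - 1) := by
    refine (Set.ncard_union_le _ _).trans (Nat.add_le_add (le_of_eq ?_) hT)
    exact (Nat.card_coe_set_eq (H : Set G)).symm
  have hpos : H.index ≠ 0 := H.index_ne_zero_of_finite
  refine ⟨H ∪ T, fun x => ?_, by omega, by omega⟩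
  by_cases hx : x ∈ H
  · exact ⟨x, Or.inl hx, Set.mem_smul_set.2 ⟨1, Or.inl H.one_mem, mul_one x⟩⟩
  · obtain ⟨h, hh⟩ := QuotientGroup.mk_out_eq_mul H x
    refine ⟨(x : G ⧸ H).out, Or.inr ⟨(x : G ⧸ H), fun hq => hx ?_, rfl⟩,
      Set.mem_smul_set.2 ⟨h, Or.inl h.2, hh.symm⟩⟩
    simpa using QuotientGroup.eq.1 (Set.mem_singleton_iff.1 hq)
end

section
/- For a finite group G the following are equivalent: (1) every self-linked subset A ⊆ G satisfies 2|A| > |G| (i.e. sl(G) = ⌈(|G|+1)/2⌉ > |G|/2); (2) G is isomorphic to one of the groups C₁ (the trivial group), C₂, C₃, C₄, C₂×C₂, C₅, the dihedral group D₆ of order 6, or C₂×C₂×C₂. -/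
open Pointwise

lemma isSelfLinked_iff {G : Type*} [Group G] {A : Set G} :
    IsSelfLinked A ↔ ∀ x : G, ∃ a ∈ A, ∃ b ∈ A, x * b = a := by
  simp only [IsSelfLinked, Set.Nonempty, Set.mem_inter_iff, Set.mem_smul_set, smul_eq_mul]

/-- `G` has a self-linked subset occupying at most half of the group. -/
def HasSmallSelfLinked (G : Type*) [Group G] : Prop :=
  ∃ A : Finset G, (∀ x : G, ∃ a ∈ A, ∃ b ∈ A, x * b = a) ∧ 2 * A.card ≤ Nat.card G

lemma forall_isSelfLinked_iff {G : Type*} [Group G] [Finite G] :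
    (∀ A : Set G, IsSelfLinked A → Nat.card G < 2 * A.ncard) ↔ ¬ HasSmallSelfLinked G := by
  simp only [HasSmallSelfLinked, isSelfLinked_iff, not_exists, not_and, not_le]
  refine ⟨fun h A hA => by simpa using h A (by simpa using hA), fun h A hA => ?_⟩
  have hf := A.toFinite
  rw [Set.ncard_eq_toFinset_card A hf]
  exact h hf.toFinset (by simpa using hA)

lemma HasSmallSelfLinked.of_mulEquiv {G H : Type*} [Group G] [Group H] (e : G ≃* H)
    (h : HasSmallSelfLinked G) : HasSmallSelfLinked H := by
  obtain ⟨A, hA, hc⟩ := h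
  refine ⟨A.map e.toEquiv.toEmbedding, fun x => ?_, by
    rwa [Finset.card_map, ← Nat.card_congr e.toEquiv]⟩
  obtain ⟨a, ha, b, hb, hab⟩ := hA (e.symm x)
  exact ⟨e a, by simpa using ha, e b, by simpa using hb, by simp [← hab]⟩

lemma HasSmallSelfLinked.of_subgroup {G : Type*} [Group G] [Finite G] (H : Subgroup G)
    (h : 2 * (Nat.card H + H.index - 1) ≤ Nat.card H * H.index) : HasSmallSelfLinked G := by
  classical
  have := Fintype.ofFinite G
  have := Fintype.ofFinite (G ⧸ H)
  refine ⟨Finset.univ.filter (· ∈ H) ∪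
    (Finset.univ.erase ((1 : G) : G ⧸ H)).image Quotient.out, fun x => ?_, ?_⟩
  · by_cases hx : x ∈ H
    · exact ⟨x, by simp [hx], 1, by simp [H.one_mem], by simp⟩
    · have hq : (x : G ⧸ H) ≠ ((1 : G) : G ⧸ H) := by
        simpa [eq_comm (a := (x : G ⧸ H)), QuotientGroup.eq] using hx
      obtain ⟨k, hk⟩ := QuotientGroup.mk_out_eq_mul H x
      exact ⟨_, Finset.mem_union_right _ (Finset.mem_image_of_mem _ (by simpa using hq)),
        k, by simp, hk.symm⟩
  · have h1 := Finset.card_union_le (Finset.univ.filter (· ∈ H))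
      ((Finset.univ.erase ((1 : G) : G ⧸ H)).image Quotient.out)
    have h2 := Finset.card_image_le (s := Finset.univ.erase ((1 : G) : G ⧸ H))
      (f := Quotient.out)
    have h3 : (Finset.univ.filter (· ∈ H)).card = Nat.card H := by
      rw [Nat.card_eq_fintype_card, Fintype.card_subtype]
    rw [Finset.card_erase_of_mem (Finset.mem_univ _), Finset.card_univ,
      ← Nat.card_eq_fintype_card, ← Subgroup.index] at h2
    have := H.index_ne_zero_of_finite
    rw [← H.card_mul_index]
    omega

lemma exists_lt_orderOf_pow_eq {G : Type*} [Group G] [Finite G] {g x : G}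
    (hx : x ∈ Subgroup.zpowers g) : ∃ k < orderOf g, g ^ k = x := by
  classical
  rw [mem_zpowers_iff_mem_range_orderOf] at hx
  simpa using hx

/-- The set `{1, g, …, g ^ (m - 2), g ^ m}`. -/
def gappedPowers {G : Type*} [Group G] [DecidableEq G] (g : G) (m : ℕ) : Finset G :=
  (insert m (Finset.range (m - 1))).image (g ^ ·)

lemma pow_mem_gappedPowers {G : Type*} [Group G] [DecidableEq G] (g : G) {m i : ℕ}
    (h : i = m ∨ i < m - 1) : g ^ i ∈ gappedPowers g m :=
  Finset.mem_image_of_mem _ (by simpa using h)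

lemma card_gappedPowers_le {G : Type*} [Group G] [DecidableEq G] (g : G) {m : ℕ} (hm : 1 ≤ m) :
    (gappedPowers g m).card ≤ m := by
  refine Finset.card_image_le.trans ((Finset.card_insert_le _ _).trans ?_)
  simp; omega

lemma gappedPowers_covers {G : Type*} [Group G] [Finite G] [DecidableEq G] {g : G} {m : ℕ}
    (hm : 3 ≤ m) (hg : orderOf g ≤ 2 * m + 1) {x : G} (hx : x ∈ Subgroup.zpowers g) :
    ∃ a ∈ gappedPowers g m, ∃ b ∈ gappedPowers g m, x * b = a := by
  obtain ⟨k, hk, rfl⟩ := exists_lt_orderOf_pow_eq hx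
  suffices h : ∃ i j, (i = m ∨ i < m - 1) ∧ (j = m ∨ j < m - 1) ∧
      (k + j = i ∨ k + j = i + orderOf g) by
    obtain ⟨i, j, hi, hj, h⟩ := h
    refine ⟨_, pow_mem_gappedPowers g hi, _, pow_mem_gappedPowers g hj, ?_⟩
    rcases h with h | h
    · rw [← pow_add, h]
    · rw [← pow_add, h, pow_add, pow_orderOf_eq_one, mul_one]
  by_cases h1 : k ≤ m
  · by_cases h2 : k = m - 1
    · exact ⟨m, 1, by omega⟩
    · exact ⟨k, 0, by omega⟩
  · by_cases h2 : orderOf g - k = m - 1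
    · exact ⟨1, m, by omega⟩
    · exact ⟨0, orderOf g - k, by omega⟩

lemma HasSmallSelfLinked.of_isCyclic {G : Type*} [Group G] [Finite G] [IsCyclic G]
    (h : 6 ≤ Nat.card G) : HasSmallSelfLinked G := by
  classical
  obtain ⟨g, hg⟩ := IsCyclic.exists_generator (α := G)
  have ho := orderOf_eq_card_of_forall_mem_zpowers hg
  have hc := card_gappedPowers_le g (m := Nat.card G / 2) (by omega)
  exact ⟨gappedPowers g (Nat.card G / 2),
    fun x => gappedPowers_covers (by omega) (by omega) (hg x), by omega⟩

lemma HasSmallSelfLinked.of_index_eq_two {G : Type*} [Group G] [Finite G] {H : Subgroup G}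
    (hH : H.index = 2) (R S : Finset G)
    (hR : ∀ x ∈ H, ∃ a ∈ R, ∃ b ∈ R, x * b = a) (hS : ∀ x ∈ H, ∃ a ∈ S, ∃ b ∈ R, x * b = a)
    (hc : R.card + S.card ≤ Nat.card H) : HasSmallSelfLinked G := by
  classical
  obtain ⟨s, hs⟩ := Subgroup.index_eq_two_iff_exists_notMem_and.mp hH
  refine ⟨R ∪ S.image (s⁻¹ * ·), fun x => ?_, ?_⟩
  · by_cases hx : x ∈ H
    · obtain ⟨a, ha, b, hb, h⟩ := hR x hx
      exact ⟨a, by simp [ha], b, by simp [hb], h⟩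
    · obtain ⟨a, ha, b, hb, h⟩ := hS (s * x) (by
        rw [Subgroup.mul_mem_iff_of_index_two hH]; tauto)
      exact ⟨s⁻¹ * a, Finset.mem_union_right _ (Finset.mem_image_of_mem _ ha), b, by simp [hb],
        by simp [← h, mul_assoc]⟩
  · have h1 := Finset.card_union_le R (S.image (s⁻¹ * ·))
    have h2 := Finset.card_image_le (s := S) (f := (s⁻¹ * ·))
    rw [← H.card_mul_index, hH]
    omega

lemma HasSmallSelfLinked.of_zpowers_index_eq_two {G : Type*} [Group G] [Finite G] {g : G}
    (hg : 5 ≤ orderOf g) (hi : (Subgroup.zpowers g).index = 2) : HasSmallSelfLinked G := by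
  classical
  rcases hg.eq_or_lt with hg | hg
  · refine .of_index_eq_two hi (gappedPowers g 3) {1, g}
      (fun x hx => gappedPowers_covers le_rfl (by omega) hx) (fun x hx => ?_) ?_
    · obtain ⟨k, hk, rfl⟩ := exists_lt_orderOf_pow_eq hx
      suffices h : ∃ i j, (i = 0 ∨ i = 1) ∧ (j = 3 ∨ j < 2) ∧
          (k + j = i ∨ k + j = i + orderOf g) by
        obtain ⟨i, j, hi, hj, h⟩ := h
        refine ⟨g ^ i, by rcases hi with rfl | rfl <;> simp, g ^ j,
          pow_mem_gappedPowers g hj, ?_⟩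
        rcases h with h | h
        · rw [← pow_add, h]
        · rw [← pow_add, h, pow_add, pow_orderOf_eq_one, mul_one]
      rw [← hg] at hk ⊢
      interval_cases k
      exacts [⟨0, 0, by omega⟩, ⟨1, 0, by omega⟩, ⟨0, 3, by omega⟩, ⟨1, 3, by omega⟩,
        ⟨0, 1, by omega⟩]
    · have h1 := card_gappedPowers_le g (m := 3) (by omega)
      have h2 := Finset.card_le_two (a := (1 : G)) (b := g)
      rw [Nat.card_zpowers]
      omega
  · have hm : 3 ≤ orderOf g / 2 := by omega
    refine .of_index_eq_two hi (gappedPowers g (orderOf g / 2))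
      ((Finset.range (orderOf g - orderOf g / 2)).image fun i => g ^ (2 * i + 1))
      (fun x hx => gappedPowers_covers hm (by omega) hx) (fun x hx => ?_) ?_
    · obtain ⟨k, hk, rfl⟩ := exists_lt_orderOf_pow_eq hx
      refine ⟨g ^ (2 * (k / 2) + 1), Finset.mem_image.mpr ⟨k / 2, by simp; omega, rfl⟩,
        g ^ (1 - k % 2), pow_mem_gappedPowers g (by omega), ?_⟩
      rw [← pow_add]
      congr 1
      omega
    · have h1 := card_gappedPowers_le g (m := orderOf g / 2) (by omega)
      have h2 := Finset.card_image_le (s := Finset.range (orderOf g - orderOf g / 2))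
        (f := fun i => g ^ (2 * i + 1))
      rw [Finset.card_range] at h2
      rw [Nat.card_zpowers]
      omega

lemma HasSmallSelfLinked.of_card_eq_eight {G : Type*} [Group G] [Finite G] {g : G}
    (hc : Nat.card G = 8) (hg : orderOf g = 4) : HasSmallSelfLinked G := by
  classical
  have hi : (Subgroup.zpowers g).index = 2 := by
    have := (Subgroup.zpowers g).card_mul_index
    rw [Nat.card_zpowers, hg, hc] at this
    omega
  have hn := Subgroup.normal_of_index_eq_two hi
  obtain ⟨s, hs⟩ := Subgroup.index_eq_two_iff_exists_notMem_and.mp hi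
  have h4 : g ^ 4 = 1 := hg ▸ pow_orderOf_eq_one g
  have hconj : g ^ 2 * s⁻¹ = s⁻¹ * g ^ 2 := by
    have hmem : s⁻¹ * g * s ∈ Subgroup.zpowers g := by
      simpa using hn.conj_mem g (Subgroup.mem_zpowers g) s⁻¹
    obtain ⟨k, hk, h⟩ := exists_lt_orderOf_pow_eq hmem
    have h2 : s⁻¹ * g ^ 2 * s = (g ^ k) ^ 2 := by
      simp only [h, sq, mul_assoc, mul_inv_cancel_left]
    have h3 : (g ^ k) ^ 2 = g ^ 2 := by
      obtain hk2 | hk2 : k * 2 % 4 = 2 ∨ k * 2 % 4 = 0 := by omega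
      · rw [← pow_mul, ← pow_mod_orderOf, hg, hk2]
      · rw [← pow_mul, ← pow_mod_orderOf g (k * 2), hg, hk2, pow_zero, mul_assoc, inv_mul_eq_one,
          eq_comm, mul_eq_right] at h2
        exact absurd (orderOf_dvd_of_pow_eq_one h2) (by rw [hg]; norm_num)
    exact mul_inv_eq_of_eq_mul (h2.trans h3).symm
  refine ⟨{1, g, s⁻¹, s⁻¹ * g ^ 2}, fun x => ?_, ?_⟩
  · by_cases hx : x ∈ Subgroup.zpowers g
    · obtain ⟨k, hk, rfl⟩ := exists_lt_orderOf_pow_eq hx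
      rw [hg] at hk
      interval_cases k
      · exact ⟨1, by simp, 1, by simp, by simp⟩
      · exact ⟨g, by simp, 1, by simp, by simp⟩
      · exact ⟨s⁻¹ * g ^ 2, by simp, s⁻¹, by simp, hconj⟩
      · exact ⟨1, by simp, g, by simp, by rw [← pow_succ, h4]⟩
    · have hx' : s * x ∈ Subgroup.zpowers g := by
        rw [Subgroup.mul_mem_iff_of_index_two hi]; tauto
      obtain ⟨k, hk, hkx⟩ := exists_lt_orderOf_pow_eq hx'
      obtain rfl : x = s⁻¹ * g ^ k := by simp [hkx]
      rw [hg] at hk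
      interval_cases k
      · exact ⟨s⁻¹, by simp, 1, by simp, by simp⟩
      · exact ⟨s⁻¹ * g ^ 2, by simp, g, by simp, by rw [mul_assoc, ← pow_succ]⟩
      · exact ⟨s⁻¹ * g ^ 2, by simp, 1, by simp, by simp⟩
      · exact ⟨s⁻¹, by simp, g, by simp, by rw [mul_assoc, ← pow_succ, h4, mul_one]⟩
  · have := Finset.card_le_four (a := (1 : G)) (b := g) (c := s⁻¹) (d := s⁻¹ * g ^ 2)
    omega

lemma HasSmallSelfLinked.of_card_eq_nine {G : Type*} [Group G] [Finite G]
    (hc : Nat.card G = 9) : HasSmallSelfLinked G := by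
  classical
  have : Fact (Nat.Prime 3) := ⟨by norm_num⟩
  have hcomm := (IsPGroup.isMulCommutative_of_card_eq_prime_sq (p := 3) (G := G) hc).is_comm.comm
  obtain ⟨g, hg⟩ := exists_prime_orderOf_dvd_card' (G := G) 3 (by simp [hc])
  set H := Subgroup.zpowers g with hH
  have hi : H.index = 3 := by
    have := H.card_mul_index
    rw [Nat.card_zpowers, hg, hc] at this
    omega
  have hn : H.Normal := ⟨fun n hn x => by rwa [hcomm x n, mul_inv_cancel_right]⟩
  have hcyc : IsCyclic (G ⧸ H) := isCyclic_of_prime_card (p := 3) hi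
  obtain ⟨q, hq⟩ := IsCyclic.exists_generator (α := G ⧸ H)
  have ho : orderOf q = 3 := (orderOf_eq_card_of_forall_mem_zpowers hq).trans hi
  obtain ⟨s, rfl⟩ := QuotientGroup.mk_surjective q
  refine ⟨insert s ((Finset.range 3).image (g ^ ·)), fun x => ?_, ?_⟩
  · have hmem : ∀ y ∈ H, y ∈ insert s ((Finset.range 3).image (g ^ ·)) := fun y hy => by
      obtain ⟨k, hk, rfl⟩ := exists_lt_orderOf_pow_eq hy
      exact Finset.mem_insert_of_mem (Finset.mem_image_of_mem _ (by simpa [hg] using hk))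
    obtain ⟨k, hk, h⟩ := exists_lt_orderOf_pow_eq (hq x)
    rw [ho] at hk
    interval_cases k
    · refine ⟨x, hmem x ?_, 1, hmem 1 H.one_mem, mul_one x⟩
      rw [← QuotientGroup.eq_one_iff, ← h, pow_zero]
    · refine ⟨s, Finset.mem_insert_self _ _, x⁻¹ * s, hmem _ ?_, by simp⟩
      rw [← QuotientGroup.eq, ← h, pow_one]
    · refine ⟨x * s, hmem _ ?_, s, Finset.mem_insert_self _ _, rfl⟩
      rw [← QuotientGroup.eq_one_iff, QuotientGroup.mk_mul, ← h, ← pow_succ]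
      simpa [ho] using pow_orderOf_eq_one (s : G ⧸ H)
  · have h1 := Finset.card_insert_le s ((Finset.range 3).image (g ^ ·))
    have h2 := Finset.card_image_le (s := Finset.range 3) (f := (g ^ ·))
    simp only [Finset.card_range] at h2
    omega

lemma nonempty_mulEquiv_dihedralGroup_three {G : Type*} [Group G] [Finite G]
    (hc : Nat.card G = 6) (hG : ¬ IsCyclic G) : Nonempty (G ≃* DihedralGroup 3) := by
  have hval : ∀ i j : ZMod 3, (j - i).val = (2 * i.val + j.val) % 3 := by decide
  have : Fact (Nat.Prime 3) := ⟨by norm_num⟩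
  have hne (x : G) : orderOf x ≠ 6 := fun h => hG (isCyclic_of_orderOf_eq_card x (h.trans hc.symm))
  have hno (x : G) (h2 : x ^ 2 ≠ 1) : x ^ 3 = 1 := by
    have hd : orderOf x ∣ 6 := hc ▸ orderOf_dvd_natCard x
    have hle := Nat.le_of_dvd (by norm_num) hd
    have h2' := mt orderOf_dvd_iff_pow_eq_one.mp h2
    rw [← orderOf_dvd_iff_pow_eq_one]
    have := hne x
    interval_cases orderOf x <;> simp_all
  obtain ⟨g, hg⟩ := exists_prime_orderOf_dvd_card' (G := G) 3 (by simp [hc])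
  have hi : (Subgroup.zpowers g).index = 2 := by
    have := (Subgroup.zpowers g).card_mul_index
    rw [Nat.card_zpowers, hg, hc] at this
    omega
  have h3 : g ^ 3 = 1 := hg ▸ pow_orderOf_eq_one g
  have hinv (x : G) (hx : x ∉ Subgroup.zpowers g) : x ^ 2 = 1 := by
    by_contra h
    refine hx ?_
    have h2 : x ^ 2 ∈ Subgroup.zpowers g := Subgroup.sq_mem_of_index_two hi x
    have := mul_mem h2 h2
    rwa [← pow_add, pow_succ, hno x h, one_mul] at this
  obtain ⟨s, hs, -⟩ := Subgroup.index_eq_two_iff_exists_notMem_and.mp hi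
  have hs2 : s * s = 1 := by rw [← sq, hinv s hs]
  have hgs : g * s = s * g ^ 2 := by
    have hsg := hinv (s * g) (by simp [Subgroup.mul_mem_iff_of_index_two hi, hs])
    calc g * s = s * (s * g) ^ 2 * g⁻¹ := by
          rw [sq, mul_assoc s g, ← mul_assoc s s, hs2]; group
      _ = s * g ^ 2 := by
          rw [hsg, mul_one, inv_eq_of_mul_eq_one_right (by rw [← pow_succ', h3])]
  let f : DihedralGroup 3 → G
    | .r i => g ^ i.val
    | .sr i => s * g ^ i.val
  have hpow (m : ℕ) : g ^ (m % 3) = g ^ m := by rw [← hg, pow_mod_orderOf]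
  have hcomm (m : ℕ) : g ^ m * s = s * g ^ (2 * m) := by
    rw [pow_mul]
    exact (show SemiconjBy s (g ^ 2) g from hgs.symm).pow_right m |>.symm
  have hsub (i j : ZMod 3) : g ^ (j - i).val = g ^ (2 * i.val + j.val) := by
    rw [hval, hpow]
  have hadd (i j : ZMod 3) : g ^ (i + j).val = g ^ (i.val + j.val) := by
    rw [ZMod.val_add, hpow]
  let F : DihedralGroup 3 →* G := MonoidHom.mk' f (by
    rintro (i | i) (j | j)
    · simp [f, hadd, pow_add]
    · simp only [f, DihedralGroup.r_mul_sr, hsub, ← mul_assoc, hcomm, pow_add]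
    · simp only [f, DihedralGroup.sr_mul_r, hadd, pow_add, mul_assoc]
    · simp only [f, DihedralGroup.sr_mul_sr, hsub]
      rw [mul_assoc, ← mul_assoc _ s, hcomm, mul_assoc, ← mul_assoc s s, hs2, one_mul, pow_add])
  have hF : Function.Injective F := by
    rw [injective_iff_map_eq_one]
    rintro (i | i) h
    · have h : g ^ i.val = 1 := h
      rw [← orderOf_dvd_iff_pow_eq_one, hg] at h
      have := Nat.eq_zero_of_dvd_of_lt h i.val_lt
      rw [ZMod.val_eq_zero] at this
      rw [this]; rfl
    · have h : s * g ^ i.val = 1 := h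
      refine absurd ?_ hs
      rw [eq_inv_of_mul_eq_one_left h]
      exact inv_mem (Subgroup.npow_mem_zpowers g _)
  exact ⟨(MulEquiv.ofBijective F ((Nat.bijective_iff_injective_and_card F).mpr
    ⟨hF, by rw [DihedralGroup.nat_card, hc]⟩)).symm⟩

lemma nonempty_mulEquiv_of_forall_sq_eq_one {G : Type*} [Group G] [Finite G]
    (h : ∀ x : G, x ^ 2 = 1) (M : Type*) [AddCommGroup M] [Module (ZMod 2) M] [Finite M]
    (hc : Nat.card G = Nat.card M) : Nonempty (G ≃* Multiplicative M) := by
  let _ : CommGroup G := { ‹Group G› with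
    mul_comm := fun a b =>
      (Commute.of_orderOf_dvd_two (fun x => orderOf_dvd_of_pow_eq_one (h x)) a b).eq }
  let _ : Module (ZMod 2) (Additive G) := AddCommGroup.zmodModule (n := 2) fun x => h x.toMul
  have hd : Module.finrank (ZMod 2) (Additive G) = Module.finrank (ZMod 2) M := by
    have h1 := Module.natCard_eq_pow_finrank (K := ZMod 2) (V := Additive G)
    have h2 := Module.natCard_eq_pow_finrank (K := ZMod 2) (V := M)
    rw [Nat.card_congr Additive.toMul, hc, h2] at h1
    exact Nat.pow_right_injective le_rfl (by simpa using h1.symm)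
  exact ⟨AddEquiv.toMultiplicativeRight (LinearEquiv.ofFinrankEq _ _ hd).toAddEquiv⟩

lemma not_hasSmallSelfLinked_of_card {G : Type*} [Group G] [Fintype G] [DecidableEq G]
    (h : ¬ ∃ A : Finset G, (∀ x : G, ∃ a ∈ A, ∃ b ∈ A, x * b = a) ∧ 2 * A.card ≤ Fintype.card G) :
    ¬ HasSmallSelfLinked G := by
  rwa [HasSmallSelfLinked, Nat.card_eq_fintype_card]

lemma not_hasSmallSelfLinked_of_forall_sq_eq_one {G : Type*} [CommGroup G] [Fintype G]
    (h : ∀ x : G, x ^ 2 = 1) (hc : Fintype.card G = 8) : ¬ HasSmallSelfLinked G := by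
  classical
  rintro ⟨A, hA, hcard⟩
  rw [Nat.card_eq_fintype_card, hc] at hcard
  obtain ⟨B, hAB, hB⟩ := Finset.exists_superset_card_eq (s := A) (n := 4) (by omega) (by omega)
  obtain ⟨a, b, c, d, -, -, -, -, -, -, rfl⟩ := Finset.card_eq_four.mp hB
  have hsq (x : G) : x * x = 1 := by rw [← sq, h]
  have hsub : (Finset.univ : Finset G) ⊆ {1, a * b, a * c, a * d, b * c, b * d, c * d} := by
    intro x _
    obtain ⟨u, hu, v, hv, hx⟩ := hA x
    obtain rfl : x = u * v := by rw [← hx, mul_assoc, hsq, mul_one]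
    have hu := hAB hu
    have hv := hAB hv
    simp only [Finset.mem_insert, Finset.mem_singleton] at hu hv ⊢
    rcases hu with rfl | rfl | rfl | rfl <;> rcases hv with rfl | rfl | rfl | rfl <;>
      simp [hsq, mul_comm]
  have h1 := Finset.card_le_card hsub
  have h2 := Finset.card_le_six (a := a * b) (b := a * c) (c := a * d) (d := b * c)
    (e := b * d) (f := c * d)
  have h3 := Finset.card_insert_le 1 ({a * b, a * c, a * d, b * c, b * d, c * d} : Finset G)
  rw [Finset.card_univ, hc] at h1
  omega

/-- For a finite group `G`, every self-linked subset `A ⊆ G` satisfies `2|A| > |G|`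
(i.e. `sl(G) = ⌈(|G|+1)/2⌉ > |G|/2`) if and only if `G` is isomorphic to one of the groups
`C₁`, `C₂`, `C₃`, `C₄`, `C₂×C₂`, `C₅`, `D₆` (dihedral of order 6), or `C₂×C₂×C₂`. -/
theorem stmt3 {G : Type*} [Group G] [Finite G] :
    (∀ A : Set G, IsSelfLinked A → Nat.card G < 2 * A.ncard) ↔
      (Nonempty (G ≃* Multiplicative (ZMod 1)) ∨
       Nonempty (G ≃* Multiplicative (ZMod 2)) ∨
       Nonempty (G ≃* Multiplicative (ZMod 3)) ∨
       Nonempty (G ≃* Multiplicative (ZMod 4)) ∨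
       Nonempty (G ≃* Multiplicative (ZMod 2 × ZMod 2)) ∨
       Nonempty (G ≃* Multiplicative (ZMod 5)) ∨
       Nonempty (G ≃* DihedralGroup 3) ∨
       Nonempty (G ≃* Multiplicative (ZMod 2 × ZMod 2 × ZMod 2))) := by
  rw [forall_isSelfLinked_iff]
  refine ⟨fun hs => ?_, ?_⟩
  · have hzmod (hG : IsCyclic G) {n : ℕ} (hc : Nat.card G = n) :
        Nonempty (G ≃* Multiplicative (ZMod n)) := hc ▸ ⟨(zmodCyclicMulEquiv hG).symm⟩
    have hcyc (hG : IsCyclic G) : Nat.card G < 6 := not_le.mp fun h => hs (.of_isCyclic h)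
    obtain ⟨m, hm⟩ | ⟨p, hp, hpd, hodd⟩ := (Nat.card G).eq_two_pow_or_exists_odd_prime_and_dvd
    · have hsq (h4 : ∀ x : G, orderOf x ≠ 4) (h8 : ∀ x : G, orderOf x ≠ 8)
          (hd : Nat.card G ∣ 8) (x : G) : x ^ 2 = 1 := by
        have hx : orderOf x ∣ 2 ^ 3 := (orderOf_dvd_natCard x).trans hd
        obtain ⟨k, hk, hk'⟩ := (Nat.dvd_prime_pow Nat.prime_two).mp hx
        rw [← orderOf_dvd_iff_pow_eq_one]
        have := h4 x
        have := h8 x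
        interval_cases k <;> simp_all
      have hgen {x : G} (hx : orderOf x = Nat.card G) : IsCyclic G :=
        isCyclic_of_orderOf_eq_card x hx
      match m, hm with
      | 0, hm => exact .inl (hzmod (isCyclic_of_card_dvd_prime (p := 2) (by simp [hm])) hm)
      | 1, hm =>
        have : Fact (Nat.Prime 2) := ⟨Nat.prime_two⟩
        exact .inr (.inl (hzmod (isCyclic_of_prime_card (p := 2) hm) hm))
      | 2, hm =>
        by_cases hG : IsCyclic G
        · exact .inr (.inr (.inr (.inl (hzmod hG hm))))
        · refine .inr (.inr (.inr (.inr (.inl ?_))))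
          refine nonempty_mulEquiv_of_forall_sq_eq_one
            (hsq (fun x hx => hG (hgen (hx.trans hm.symm)))
            (fun x hx => ?_) (by norm_num [hm])) _ (by simp [hm])
          have := orderOf_dvd_natCard x
          rw [hx, hm] at this
          norm_num at this
      | 3, hm =>
        refine .inr (.inr (.inr (.inr (.inr (.inr (.inr ?_))))))
        refine nonempty_mulEquiv_of_forall_sq_eq_one (hsq (fun x hx => hs (.of_card_eq_eight hm hx))
          (fun x hx => ?_) (by norm_num [hm])) _ (by simp [hm])
        have := hcyc (hgen (hx.trans hm.symm))
        omega
      | m + 4, hm =>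
        have : Fact (Nat.Prime 2) := ⟨Nat.prime_two⟩
        obtain ⟨H, hH⟩ := Sylow.exists_subgroup_card_pow_prime (G := G) 2 (n := 2)
          (hm ▸ pow_dvd_pow 2 (by omega))
        have h := H.card_mul_index
        have hpos : 1 ≤ 2 ^ m := Nat.one_le_two_pow
        rw [hH, hm, pow_add] at h
        exact (hs (.of_subgroup H (by rw [hH]; omega))).elim
    · have := Fact.mk hp
      obtain ⟨g, hg⟩ := exists_prime_orderOf_dvd_card' p hpd
      have hp3 : 3 ≤ p := by
        have := hp.two_le
        obtain ⟨r, rfl⟩ := hodd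
        omega
      have hmul := (Subgroup.zpowers g).card_mul_index
      have hpos := (Subgroup.zpowers g).index_ne_zero_of_finite
      rw [Nat.card_zpowers, hg] at hmul
      obtain h | h | h | h : (Subgroup.zpowers g).index = 1 ∨ (Subgroup.zpowers g).index = 2 ∨
          (p = 3 ∧ (Subgroup.zpowers g).index = 3) ∨
          2 * (p + (Subgroup.zpowers g).index - 1) ≤ p * (Subgroup.zpowers g).index := by
        generalize (Subgroup.zpowers g).index = k at hpos
        by_cases hk : 3 ≤ k
        · obtain ⟨a, rfl⟩ := Nat.exists_eq_add_of_le hp3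
          obtain ⟨b, rfl⟩ := Nat.exists_eq_add_of_le hk
          have : (3 + a) * (3 + b) = 9 + 3 * a + 3 * b + a * b := by ring
          omega
        · omega
      · rw [h, mul_one] at hmul
        have hG := isCyclic_of_prime_card hmul.symm
        have := hcyc hG
        obtain rfl | rfl | rfl : p = 3 ∨ p = 4 ∨ p = 5 := by omega
        · exact .inr (.inr (.inl (hzmod hG hmul.symm)))
        · exact absurd hp (by norm_num)
        · exact .inr (.inr (.inr (.inr (.inr (.inl (hzmod hG hmul.symm))))))
      · have : p < 5 := by
          by_contra! h5
          exact hs (.of_zpowers_index_eq_two (hg ▸ h5) h)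
        obtain rfl : p = 3 := by
          obtain ⟨r, rfl⟩ := hodd
          omega
        rw [h] at hmul
        refine .inr (.inr (.inr (.inr (.inr (.inr (.inl ?_))))))
        refine nonempty_mulEquiv_dihedralGroup_three hmul.symm fun hG => ?_
        have := hcyc hG
        omega
      · rw [h.1, h.2] at hmul
        exact (hs (.of_card_eq_nine hmul.symm)).elim
      · exact (hs (.of_subgroup (Subgroup.zpowers g) (by rwa [Nat.card_zpowers, hg]))).elim
  · rintro (⟨⟨e⟩⟩ | ⟨⟨e⟩⟩ | ⟨⟨e⟩⟩ | ⟨⟨e⟩⟩ | ⟨⟨e⟩⟩ | ⟨⟨e⟩⟩ | ⟨⟨e⟩⟩ | ⟨⟨e⟩⟩) <;>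
      refine mt (HasSmallSelfLinked.of_mulEquiv e) ?_
    case inr.inr.inr.inr.inr.inr.inr =>
      exact not_hasSmallSelfLinked_of_forall_sq_eq_one (by decide) (by decide)
    all_goals exact not_hasSmallSelfLinked_of_card (by decide +kernel)
end

section
/- The smallest cardinality of a self-linked subset of the cyclic group C₁₂ of order 12 equals 4: there exists a self-linked subset A ⊆ C₁₂ with |A| = 4, and every self-linked subset of C₁₂ has at least 4 elements. -/
open Pointwise

/-- A subset `A` of an additive group `G` is *self-linked* if `A ∩ (x + A) ≠ ∅`
for every `x ∈ G`. -/
def IsAddSelfLinked {G : Type*} [AddGroup G] (A : Set G) : Prop :=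
  ∀ x : G, (A ∩ (x +ᵥ A)).Nonempty

theorem isAddSelfLinked_iff_exists_sub_eq {G : Type*} [AddGroup G] {A : Set G} :
    IsAddSelfLinked A ↔ ∀ x : G, ∃ a ∈ A, ∃ b ∈ A, a - b = x := by
  refine forall_congr' fun x => ⟨?_, ?_⟩
  · rintro ⟨_, ha, b, hb, rfl⟩
    exact ⟨_, ha, b, hb, add_sub_cancel_right x b⟩
  · rintro ⟨a, ha, b, hb, rfl⟩
    exact ⟨a, ha, b, hb, sub_add_cancel a b⟩

/-- The nonzero elements of `G` are differences of ordered pairs of distinct elements of a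
self-linked set. -/
theorem IsAddSelfLinked.card_le {G : Type*} [AddGroup G] [Fintype G] [DecidableEq G]
    {s : Finset G} (hs : IsAddSelfLinked (s : Set G)) :
    Fintype.card G ≤ s.card * s.card - s.card + 1 := by
  have hsub : (Finset.univ : Finset G) ⊆ insert 0 (s.offDiag.image fun p => p.1 - p.2) := by
    intro x _
    obtain ⟨a, ha, b, hb, rfl⟩ := isAddSelfLinked_iff_exists_sub_eq.1 hs x
    rw [Finset.mem_insert, Finset.mem_image, sub_eq_zero]
    exact or_iff_not_imp_left.2 fun hab =>
      ⟨(a, b), Finset.mem_offDiag.2 ⟨ha, hb, hab⟩, rfl⟩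
  calc Fintype.card G ≤ (insert 0 (s.offDiag.image fun p => p.1 - p.2)).card :=
        Finset.card_le_card hsub
    _ ≤ (s.offDiag.image fun p => p.1 - p.2).card + 1 := Finset.card_insert_le _ _
    _ ≤ s.offDiag.card + 1 := Nat.add_le_add_right Finset.card_image_le 1
    _ = s.card * s.card - s.card + 1 := by rw [Finset.offDiag_card]

/-- The smallest cardinality of a self-linked subset of the cyclic group `C₁₂` of order 12
equals 4: there is a self-linked 4-element subset, and every self-linked subset has at
least 4 elements. -/
theorem stmt5 :
    (∃ A : Set (ZMod 12), IsAddSelfLinked A ∧ A.ncard = 4) ∧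
    (∀ A : Set (ZMod 12), IsAddSelfLinked A → 4 ≤ A.ncard) := by
  constructor
  · refine ⟨(({0, 1, 3, 7} : Finset (ZMod 12)) : Set (ZMod 12)), ?_, ?_⟩
    · rw [isAddSelfLinked_iff_exists_sub_eq]
      simp only [Finset.mem_coe]
      decide
    · rw [Set.ncard_coe_finset]
      decide
  · intro A hA
    lift A to Finset (ZMod 12) using A.toFinite
    rw [Set.ncard_coe_finset]
    have hcard := hA.card_le
    rw [ZMod.card] at hcard
    by_contra! hlt
    interval_cases A.card <;> omega
end

section
/- The smallest cardinality of a self-linked subset of the alternating group A₄ on 4 letters equals 5: there exists a self-linked subset A ⊆ A₄ with |A| = 5, and every self-linked subset of A₄ has at least 5 elements. -/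
open Pointwise

open Finset in
/-- In a product set `A * A⁻¹` covering a finite group, every involution is represented twice
and every other nontrivial element at least once. -/
theorem card_add_card_involutions_le_of_isSelfLinked {G : Type*} [Group G] [Fintype G]
    [DecidableEq G] (A : Finset G) (hA : IsSelfLinked (A : Set G)) :
    #{x : G | x ≠ 1} + #{x : G | x ≠ 1 ∧ x * x = 1} ≤ #A.offDiag := by
  have hmaps : ∀ p ∈ A.offDiag, p.1 * p.2⁻¹ ∈ ({x : G | x ≠ 1} : Finset G) := by
    intro p hp
    simpa [mul_inv_eq_one] using (mem_offDiag.1 hp).2.2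
  rw [card_eq_sum_card_fiberwise hmaps, card_eq_sum_ones, ← filter_filter,
    card_filter, ← sum_add_distrib]
  refine sum_le_sum fun x hx => ?_
  have hx1 : x ≠ 1 := by simpa using hx
  obtain ⟨a, ha, b, hb, hab⟩ := hA x
  have hab : x * b = a := hab
  have hne : a ≠ b := by
    rintro rfl
    exact hx1 (by simpa using hab)
  have hmem : (a, b) ∈ A.offDiag.filter fun p => p.1 * p.2⁻¹ = x := by
    simp [← hab] at ha hne ⊢
    exact ⟨ha, hb, hne⟩
  split_ifs with hxx
  · refine one_lt_card.2 ⟨(a, b), hmem, (b, a), ?_, fun h => hne (congrArg Prod.fst h)⟩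
    have hba : b * a⁻¹ = x := by
      rw [← hab, mul_inv_rev, mul_inv_cancel_left, inv_eq_of_mul_eq_one_left hxx]
    exact mem_filter.2 ⟨mem_offDiag.2 ⟨hb, ha, hne.symm⟩, hba⟩
  · exact card_pos.2 ⟨_, hmem⟩

open Equiv in
/-- A self-linked subset of the alternating group on four letters with five elements. -/
def selfLinkedFinset : Finset (alternatingGroup (Fin 4)) :=
  {1, ⟨swap 1 2 * swap 2 3, Perm.mem_alternatingGroup.2 (by decide)⟩,
    ⟨swap 2 3 * swap 1 2, Perm.mem_alternatingGroup.2 (by decide)⟩,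
    ⟨swap 0 1 * swap 2 3, Perm.mem_alternatingGroup.2 (by decide)⟩,
    ⟨swap 0 2 * swap 1 3, Perm.mem_alternatingGroup.2 (by decide)⟩}

/-- The smallest cardinality of a self-linked subset of the alternating group `A₄`
on 4 letters equals 5: there is a self-linked 5-element subset, and every self-linked
subset has at least 5 elements. -/
theorem stmt6 :
    (∃ A : Set ↥(alternatingGroup (Fin 4)), IsSelfLinked A ∧ A.ncard = 5) ∧
    (∀ A : Set ↥(alternatingGroup (Fin 4)), IsSelfLinked A → 5 ≤ A.ncard) := by
  refine ⟨⟨selfLinkedFinset, fun x => ?_, ?_⟩, fun A hA => ?_⟩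
  · have key : ∀ x, ∃ b ∈ selfLinkedFinset, x * b ∈ selfLinkedFinset := by
      decide +kernel
    obtain ⟨b, hb, hxb⟩ := key x
    exact ⟨x * b, hxb, b, hb, rfl⟩
  · rw [Set.ncard_coe_finset]
    decide +kernel
  · obtain ⟨B, rfl⟩ := A.toFinite.exists_finset_coe
    have hB := card_add_card_involutions_le_of_isSelfLinked B hA
    have hcount : ({x | x ≠ 1} : Finset (alternatingGroup (Fin 4))).card +
        ({x | x ≠ 1 ∧ x * x = 1} : Finset (alternatingGroup (Fin 4))).card = 14 := by
      decide +kernel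
    rw [hcount, Finset.offDiag_card] at hB
    rw [Set.ncard_coe_finset]
    by_contra! hlt
    interval_cases B.card <;> omega
end

section
/- For every group X the set of maximal invariant linked systems on X is nonempty, and it is rectangular with respect to the operation ∘: for any two maximal invariant linked systems A and B on X one has A∘B = B. -/
open Pointwise

/-- A family `L` of subsets of `X` is *linked* if any two of its members intersect
(in particular every member is nonempty). -/
def Linked {X : Type*} (L : Set (Set X)) : Prop :=
  ∀ A ∈ L, ∀ B ∈ L, (A ∩ B).Nonempty

/-- A family `L` of subsets of a group `X` is *invariant* if `xA ∈ L` for all `A ∈ L`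
and all `x ∈ X`. -/
def Invariant {X : Type*} [Group X] (L : Set (Set X)) : Prop :=
  ∀ x : X, ∀ A ∈ L, x • A ∈ L

/-- A *maximal invariant linked system* on a group `X` is an invariant linked family of
subsets of `X` not properly contained in any other invariant linked family. -/
def IsMaxInvLinked {X : Type*} [Group X] (L : Set (Set X)) : Prop :=
  Linked L ∧ Invariant L ∧
    ∀ M : Set (Set X), Linked M → Invariant M → L ⊆ M → M = L

/-- A *maximal linked system* on `X` is a linked family of subsets of `X` not properly
contained in any other linked family. -/
def IsMaxLinked {X : Type*} (L : Set (Set X)) : Prop :=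
  Linked L ∧ ∀ M : Set (Set X), Linked M → L ⊆ M → M = L

/-- The operation `A∘B = {C ⊆ X : {x ∈ X : x⁻¹C ∈ B} ∈ A}`, where
`x⁻¹C = {y ∈ X : xy ∈ C}`. -/
def circ {X : Type*} [Group X] (A B : Set (Set X)) : Set (Set X) :=
  {C : Set X | {x : X | (x * ·) ⁻¹' C ∈ B} ∈ A}

theorem exists_isMaxInvLinked (X : Type*) [Group X] :
    ∃ L : Set (Set X), IsMaxInvLinked L := by
  obtain ⟨L, hL⟩ := zorn_subset {L : Set (Set X) | Linked L ∧ Invariant L} fun c hc hchain => by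
    refine ⟨⋃₀ c, ⟨?_, ?_⟩, fun s hs => Set.subset_sUnion_of_mem hs⟩
    · rintro A ⟨s, hs, hA⟩ B ⟨t, ht, hB⟩
      rcases hchain.total hs ht with h | h
      · exact (hc ht).1 A (h hA) B hB
      · exact (hc hs).1 A hA B (h hB)
    · rintro x A ⟨s, hs, hA⟩
      exact ⟨s, hs, (hc hs).2 x A hA⟩
  exact ⟨L, hL.prop.1, hL.prop.2, fun M hM hM' h => (hL.eq_of_subset ⟨hM, hM'⟩ h).symm⟩

theorem Linked.empty_notMem {X : Type*} {L : Set (Set X)} (hL : Linked L) : ∅ ∉ L :=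
  fun h => by simpa using hL ∅ h ∅ h

theorem IsMaxInvLinked.univ_mem {X : Type*} [Group X] {L : Set (Set X)}
    (hL : IsMaxInvLinked L) : Set.univ ∈ L := by
  obtain ⟨hlinked, hinv, hmax⟩ := hL
  have hlinked' : Linked (insert Set.univ L) := by
    rintro A (rfl | hA) B (rfl | hB)
    · exact ⟨1, trivial, trivial⟩
    · simpa using hlinked B hB B hB
    · simpa using hlinked A hA A hA
    · exact hlinked A hA B hB
  have hinv' : Invariant (insert Set.univ L) := by
    rintro x A (rfl | hA)
    · exact Or.inl Set.smul_set_univ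
    · exact Or.inr (hinv x A hA)
  exact hmax _ hlinked' hinv' (Set.subset_insert _ _) ▸ Set.mem_insert _ _

theorem Invariant.preimage_mul_left_mem_iff {X : Type*} [Group X] {L : Set (Set X)}
    (hL : Invariant L) (x : X) (C : Set X) : (x * ·) ⁻¹' C ∈ L ↔ C ∈ L := by
  have h : (x * ·) ⁻¹' C = x⁻¹ • C := by
    ext y
    simp [Set.mem_inv_smul_set_iff]
  rw [h]
  exact ⟨fun hC => by simpa using hL x _ hC, hL x⁻¹ C⟩

/-- For every group `X` the set of maximal invariant linked systems is nonempty and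
rectangular: `A∘B = B` for any two maximal invariant linked systems `A`, `B`. -/
theorem stmt7 {X : Type*} [Group X] :
    (∃ L : Set (Set X), IsMaxInvLinked L) ∧
    (∀ A B : Set (Set X), IsMaxInvLinked A → IsMaxInvLinked B → circ A B = B) := by
  refine ⟨exists_isMaxInvLinked X, fun A B hA hB => ?_⟩
  ext C
  by_cases hC : C ∈ B
  · simp [circ, hB.2.1.preimage_mul_left_mem_iff, hC, hA.univ_mem]
  · simp [circ, hB.2.1.preimage_mul_left_mem_iff, hC, hA.1.empty_notMem]
end

section
/- For every infinite group X, the set of maximal invariant linked systems on X has cardinality exactly 2^(2^|X|). -/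
open Pointwise

universe u

/-- Every invariant linked family extends to a maximal invariant linked system. -/
theorem Linked.exists_le_isMaxInvLinked {X : Type*} [Group X] {L : Set (Set X)}
    (hL : Linked L) (hi : Invariant L) : ∃ M, L ⊆ M ∧ IsMaxInvLinked M := by
  obtain ⟨M, hLM, hM⟩ := zorn_subset_nonempty {M : Set (Set X) | Linked M ∧ Invariant M}
    (fun C hC hchain _ => by
      refine ⟨⋃₀ C, ⟨?_, ?_⟩, fun s hs => Set.subset_sUnion_of_mem hs⟩
      · rintro A ⟨M, hM, hA⟩ B ⟨N, hN, hB⟩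
        rcases hchain.total hM hN with h | h
        · exact (hC hN).1 A (h hA) B hB
        · exact (hC hM).1 A hA B (h hB)
      · rintro x A ⟨M, hM, hA⟩
        exact ⟨M, hM, (hC hM).2 x A hA⟩)
    L ⟨hL, hi⟩
  exact ⟨M, hLM, hM.prop.1, hM.prop.2, fun N hN hN' h =>
    (hM.eq_of_subset ⟨hN, hN'⟩ h).symm⟩

open Cardinal in
/-- For every family of at most `|X|` elements `g q` of an infinite group `X`, there are points
`y q` such that the sets `{y q, g q * y q}` are pairwise disjoint. -/
theorem exists_pairwise_disjoint_pair_mul {X Q : Type u} [Group X] [Infinite X]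
    (hQ : #Q ≤ #X) (g : Q → X) :
    ∃ y : Q → X, Pairwise fun p q => Disjoint ({y p, g p * y p} : Set X) {y q, g q * y q} := by
  obtain ⟨r, hr, hord⟩ := exists_ord_eq Q
  have hseg (q : Q) : #{p // r p q} < #X := (card_typein_lt q hord).trans_le hQ
  have step (q : Q) (z : {p // r p q} → X) :
      ∃ x : X, ∀ p : {p // r p q}, Disjoint ({z p, g p * z p} : Set X) {x, g q * x} := by
    set B : Set X := Set.range z ∪ Set.range fun p => g p.1 * z p
    have hBX : #B < #X := by
      refine (mk_union_le _ _).trans_lt (add_lt_of_lt (aleph0_le_mk X) ?_ ?_) <;>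
        exact mk_range_le.trans_lt (hseg q)
    have hlt : #(B ∪ (g q * ·) ⁻¹' B : Set X) < #X := by
      refine (mk_union_le _ _).trans_lt (add_lt_of_lt (aleph0_le_mk X) hBX ?_)
      exact (mk_preimage_of_injective _ _ (mul_right_injective (g q))).trans_lt hBX
    obtain ⟨x, hx⟩ : ∃ x, x ∉ B ∪ (g q * ·) ⁻¹' B := by
      by_contra! h
      rw [Set.eq_univ_of_forall h, mk_univ] at hlt
      exact hlt.false
    refine ⟨x, fun p => Set.disjoint_left.2 fun a ha hax => hx ?_⟩
    have haB : a ∈ B := by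
      rcases ha with rfl | rfl
      · exact Or.inl ⟨p, rfl⟩
      · exact Or.inr ⟨p, rfl⟩
    rcases hax with rfl | rfl
    · exact Or.inl haB
    · exact Or.inr haB
  choose F hF using step
  have hwf : WellFounded r := hr.wf
  let y : Q → X := hwf.fix fun q z => F q fun p => z p.1 p.2
  have hy (q : Q) : y q = F q fun p => y p.1 := hwf.fix_eq _ q
  have key (p q : Q) (h : r p q) : Disjoint ({y p, g p * y p} : Set X) {y q, g q * y q} := by
    have := hF q (fun p => y p.1) ⟨p, h⟩
    rwa [← hy q] at this
  refine ⟨y, fun p q hpq => ?_⟩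
  rcases trichotomous_of r p q with h | h | h
  · exact key p q h
  · exact absurd h hpq
  · exact (key q p h).symm

open Cardinal in
/-- An infinite group can be coloured by `T`, with `|T| ≤ |X|`, so that every left translation
maps, for every colour, some point of this colour to a point of the same colour. -/
theorem exists_coloring_mul {X T : Type u} [Group X] [Infinite X] [Nonempty T]
    (hT : #T ≤ #X) :
    ∃ c : X → T, ∀ g t, ∃ y, c y = t ∧ c (g * y) = t := by
  classical
  obtain ⟨y, hy⟩ := exists_pairwise_disjoint_pair_mul (X := X) (Q := X × T)
    (by simpa using mul_le_of_le (aleph0_le_mk X) le_rfl hT) Prod.fst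
  let P (x : X) (q : X × T) : Prop := x ∈ ({y q, q.1 * y q} : Set X)
  have huniq {x : X} {p q : X × T} (hp : P x p) (hq : P x q) : p = q := by
    by_contra h
    exact Set.disjoint_left.1 (hy h) hp hq
  let c (x : X) : T := if h : ∃ q, P x q then h.choose.2 else Classical.arbitrary T
  have hc {x : X} {q : X × T} (h : P x q) : c x = q.2 := by
    have h' : ∃ q, P x q := ⟨q, h⟩
    simp only [c, dif_pos h']
    rw [huniq h'.choose_spec h]
  exact ⟨c, fun g t => ⟨y (g, t), hc (q := (g, t)) (Or.inl rfl), hc (q := (g, t)) (Or.inr rfl)⟩⟩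

/-- A family, indexed by the subsets of `X`, of pairwise independent predicates. -/
def indepPred {X : Type*} (S : Set X) : (X × Prop) ⊕ Prop → Prop
  | .inl (x, p) => x ∈ S ↔ p
  | .inr p => p

theorem exists_indepPred {X : Type*} {S S' : Set X} {p p' : Prop} (h : S = S' → (p ↔ p')) :
    ∃ t, (indepPred S t ↔ p) ∧ (indepPred S' t ↔ p') := by
  by_cases hp : p ↔ p'
  · exact ⟨.inr p, Iff.rfl, hp⟩
  · obtain ⟨x, hx⟩ : ∃ x, ¬(x ∈ S ↔ x ∈ S') := by
      by_contra! h'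
      exact hp (h (Set.ext h'))
    refine ⟨.inl (x, x ∈ S ↔ p), ?_, ?_⟩ <;> simp only [indepPred] <;> tauto

open Cardinal in
/-- In an infinite group there are `2 ^ |X|` sets `{x | R S x}` such that any two members of
distinct pairs `({x | R S x}, {x | ¬ R S x})` have intersecting translates, and so does every
member of a pair with itself. -/
theorem exists_independent_translates (X : Type*) [Group X] [Infinite X] :
    ∃ R : Set X → X → Prop, ∀ S S' (p p' : Prop), (S = S' → (p ↔ p')) →
      ∀ g, ∃ y, (R S (g * y) ↔ p) ∧ (R S' y ↔ p') := by
  obtain ⟨c, hc⟩ := exists_coloring_mul (X := X) (T := (X × Prop) ⊕ Prop) (by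
    have hX := aleph0_le_mk X
    have h2 : (2 : Cardinal) ≤ #X := (natCast_le_aleph0 (n := 2)).trans hX
    rw [mk_sum, mk_prod, lift_uzero, lift_uzero, mk_Prop, lift_ofNat]
    exact add_le_of_le hX (mul_le_of_le hX le_rfl h2) h2)
  refine ⟨fun S x => indepPred S (c x), fun S S' p p' h g => ?_⟩
  obtain ⟨t, ht, ht'⟩ := exists_indepPred h
  obtain ⟨y, hy, hgy⟩ := hc g t
  exact ⟨y, by simpa only [hgy] using ht, by simpa only [hy] using ht'⟩

/-- For every infinite group `X`, the set of maximal invariant linked systems on `X` has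
cardinality exactly `2^(2^|X|)`. -/
theorem stmt8 {X : Type*} [Group X] [Infinite X] :
    Cardinal.mk {L : Set (Set X) // IsMaxInvLinked L}
      = 2 ^ ((2 : Cardinal) ^ Cardinal.mk X) := by
  rw [← Cardinal.mk_set, ← Cardinal.mk_set]
  refine le_antisymm (Cardinal.mk_subtype_le _) ?_
  obtain ⟨R, hR⟩ := exists_independent_translates X
  let A (f : Set (Set X)) (S : Set X) : Set X := {x | R S x ↔ S ∈ f}
  have hex (f : Set (Set X)) : ∃ M, (∀ S, A f S ∈ M) ∧ IsMaxInvLinked M := by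
    let L : Set (Set X) := {B | ∃ (x : X) (S : Set X), B = x • A f S}
    have hL : Linked L := by
      rintro _ ⟨x, S, rfl⟩ _ ⟨x', S', rfl⟩
      obtain ⟨y, hy, hy'⟩ := hR S S' (S ∈ f) (S' ∈ f) (by rintro rfl; rfl) (x⁻¹ * x')
      refine ⟨x' * y, ?_, Set.smul_mem_smul_set hy'⟩
      rw [Set.mem_smul_set_iff_inv_smul_mem, smul_eq_mul, ← mul_assoc]
      exact hy
    have hi : Invariant L := by
      rintro z _ ⟨x, S, rfl⟩
      exact ⟨z * x, S, smul_smul z x _⟩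
    obtain ⟨M, hLM, hM⟩ := hL.exists_le_isMaxInvLinked hi
    exact ⟨M, fun S => hLM ⟨1, S, (one_smul X _).symm⟩, hM⟩
  choose M hAM hM using hex
  refine Cardinal.mk_le_of_injective (f := fun f => ⟨M f, hM f⟩) fun f f' hff' => ?_
  have hMM : M f = M f' := congrArg Subtype.val hff'
  ext S
  obtain ⟨x, hx, hx'⟩ := (hM f').1 _ (hMM ▸ hAM f S) _ (hAM f' S)
  exact Iff.trans (Iff.symm hx) hx'
end

section
/- Let G be a finite group such that every self-linked subset A ⊆ G satisfies 2|A| ≥ |G| (i.e. sl(G) ≥ |G|/2). Then every maximal invariant linked system on G contains the family L₀ = {A ⊆ G : 2|A| > |G|}, i.e. every subset of G with more than |G|/2 elements belongs to every maximal invariant linked system. -/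
open Pointwise

/-- Two subsets of a finite type whose sizes add up to more than the size of the type intersect. -/
theorem inter_nonempty_of_card_lt_ncard_add_ncard {X : Type*} [Finite X] {A B : Set X}
    (h : Nat.card X < A.ncard + B.ncard) : (A ∩ B).Nonempty := by
  by_contra hne
  have hdisj : Disjoint A B :=
    Set.disjoint_iff_inter_eq_empty.mpr (Set.not_nonempty_iff_eq_empty.mp hne)
  have hle := Set.ncard_le_card (A ∪ B)
  rw [Set.ncard_union_eq hdisj] at hle
  omega

/-- Adjoining to a linked family all sets with more than half of the elements keeps it
linked, provided all its members have at least half of the elements. -/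
theorem Linked.union_setOf_card_lt {X : Type*} [Finite X] {L : Set (Set X)} (hL : Linked L)
    (hcard : ∀ A ∈ L, Nat.card X ≤ 2 * A.ncard) :
    Linked (L ∪ {A | Nat.card X < 2 * A.ncard}) := by
  rintro A (hA | hA) B (hB | hB)
  · exact hL A hA B hB
  · have := hcard A hA
    rw [Set.mem_ofPred_eq] at hB
    exact inter_nonempty_of_card_lt_ncard_add_ncard (by omega)
  · have := hcard B hB
    rw [Set.mem_ofPred_eq] at hA
    exact inter_nonempty_of_card_lt_ncard_add_ncard (by omega)
  · rw [Set.mem_ofPred_eq] at hA hB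
    exact inter_nonempty_of_card_lt_ncard_add_ncard (by omega)

theorem Invariant.union_setOf_card_lt {X : Type*} [Group X] {L : Set (Set X)}
    (hL : Invariant L) : Invariant (L ∪ {A | Nat.card X < 2 * A.ncard}) := by
  rintro x A (hA | hA)
  · exact Or.inl (hL x A hA)
  · refine Or.inr ?_
    rwa [Set.mem_ofPred_eq, Set.ncard_smul_set]

/-- If every self-linked subset `A` of a finite group `G` satisfies `2|A| ≥ |G|`
(i.e. `sl(G) ≥ |G|/2`), then every maximal invariant linked system on `G` contains every
subset of `G` with more than `|G|/2` elements. -/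
theorem stmt9 {G : Type*} [Group G] [Finite G]
    (hsl : ∀ A : Set G, (∀ x : G, (A ∩ x • A).Nonempty) → Nat.card G ≤ 2 * A.ncard) :
    ∀ L : Set (Set G), IsMaxInvLinked L →
      ∀ A : Set G, Nat.card G < 2 * A.ncard → A ∈ L := by
  rintro L ⟨hlink, hinv, hmax⟩ A hA
  have hcard : ∀ B ∈ L, Nat.card G ≤ 2 * B.ncard := fun B hB =>
    hsl B fun x => hlink B hB _ (hinv x B hB)
  rw [← hmax _ (hlink.union_setOf_card_lt hcard) hinv.union_setOf_card_lt
    Set.subset_union_left]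
  exact Or.inr hA
end

section
/- Let G be a finite group of even order and let S = {A ⊆ G : A is self-linked and 2|A| = |G|}. Define a relation ∼ on S by A ∼ B iff there exists x ∈ G with A = xB or G∖A = xB. Then ∼ is an equivalence relation on S, and the set of maximal invariant linked systems on G that contain L₀ = {A ⊆ G : 2|A| > |G|} has cardinality exactly 2^s, where s is the number of equivalence classes of ∼ on S. In particular the number of maximal invariant linked systems on G is at least 2^s. -/
open Pointwise

/-- The self-linked subsets of `G` that contain exactly half of its elements. -/
def selfLinkedHalves (G : Type*) [Group G] : Set (Set G) :=
  {A : Set G | (∀ x : G, (A ∩ x • A).Nonempty) ∧ 2 * A.ncard = Nat.card G}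

/-- The subsets of `G` that contain more than half of its elements. -/
def largeSets (G : Type*) : Set (Set G) :=
  {A : Set G | Nat.card G < 2 * A.ncard}

/-- Two sets are related if one is a translate of the other or of its complement. -/
def TranslateOrCompl {G : Type*} [Group G] (A B : Set G) : Prop :=
  ∃ x : G, A = x • B ∨ Aᶜ = x • B

section Translates

variable {G : Type*} [Group G]

theorem TranslateOrCompl.refl (A : Set G) : TranslateOrCompl A A :=
  ⟨1, Or.inl (one_smul G A).symm⟩

theorem TranslateOrCompl.symm {A B : Set G} (h : TranslateOrCompl A B) :
    TranslateOrCompl B A := by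
  obtain ⟨x, h | h⟩ := h
  · exact ⟨x⁻¹, Or.inl (by rw [h, inv_smul_smul])⟩
  · refine ⟨x⁻¹, Or.inr ?_⟩
    rw [eq_inv_smul_iff, Set.smul_set_compl, ← h, compl_compl]

theorem TranslateOrCompl.trans {A B C : Set G} (h : TranslateOrCompl A B)
    (h' : TranslateOrCompl B C) : TranslateOrCompl A C := by
  obtain ⟨x, h⟩ := h
  obtain ⟨y, h'⟩ := h'
  refine ⟨x * y, ?_⟩
  rw [mul_smul]
  rcases h' with h' | h'
  · rwa [← h']
  · rw [← h', Set.smul_set_compl, eq_compl_comm, compl_inj_iff]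
    rcases h with h | h
    · exact Or.inr h
    · exact Or.inl h.symm

theorem Invariant.smul_mem_iff {L : Set (Set G)} (hL : Invariant L) {x : G} {A : Set G} :
    x • A ∈ L ↔ A ∈ L :=
  ⟨fun h => by simpa using hL x⁻¹ _ h, hL x A⟩

theorem Linked.compl_notMem {X : Type*} {L : Set (Set X)} (hL : Linked L) {A : Set X}
    (hA : A ∈ L) : Aᶜ ∉ L := fun h => by
  simpa using hL A hA _ h

theorem ncard_smul_set (x : G) (A : Set G) : (x • A).ncard = A.ncard :=
  Set.ncard_image_of_injective A (MulAction.injective x)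

theorem smul_mem_selfLinkedHalves {A : Set G} (hA : A ∈ selfLinkedHalves G) (x : G) :
    x • A ∈ selfLinkedHalves G := by
  refine ⟨fun y => ?_, by rw [ncard_smul_set]; exact hA.2⟩
  have h := (hA.1 (x⁻¹ * y * x)).smul_set (a := x)
  rwa [Set.smul_set_inter, smul_smul, mul_assoc, mul_inv_cancel_left, mul_smul] at h

theorem compl_ne_smul {A : Set G} (hA : A ∈ selfLinkedHalves G) (x : G) : Aᶜ ≠ x • A := by
  intro h
  simpa [← h] using hA.1 x

/-- The family consisting of the large sets, the translates of the members of `P`, and the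
translates of the complements of the members of `R \ P`. -/
def systemOfChoice (R P : Set (Set G)) : Set (Set G) :=
  largeSets G ∪ {A | ∃ B ∈ R, ∃ x : G, (B ∈ P ∧ A = x • B) ∨ (B ∉ P ∧ Aᶜ = x • B)}

theorem systemOfChoice_inter {R : Set (Set G)} (hR : R ⊆ selfLinkedHalves G)
    (huniq : ∀ B ∈ R, ∀ C ∈ R, TranslateOrCompl B C → B = C) {P : Set (Set G)} (hP : P ⊆ R) :
    systemOfChoice R P ∩ R = P := by
  ext A
  constructor
  · rintro ⟨hA | ⟨B, hB, x, h⟩, hAR⟩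
    · exact absurd (hR hAR).2 (ne_of_gt hA)
    · obtain rfl := huniq A hAR B hB ⟨x, h.imp And.right And.right⟩
      rcases h with h | h
      · exact h.1
      · exact absurd h.2 (compl_ne_smul (hR hAR) x)
  · exact fun hA => ⟨Or.inr ⟨A, hP hA, 1, Or.inl ⟨hA, (one_smul G A).symm⟩⟩, hP hA⟩

variable [Finite G]

theorem compl_mem_selfLinkedHalves {A : Set G} (hA : A ∈ selfLinkedHalves G) :
    Aᶜ ∈ selfLinkedHalves G := by
  have hc := Set.ncard_add_ncard_compl A
  have hA2 := hA.2
  refine ⟨fun x => ?_, by omega⟩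
  by_contra h
  rw [Set.not_nonempty_iff_eq_empty, ← Set.disjoint_iff_inter_eq_empty] at h
  have hsub : x • Aᶜ ⊆ A := by
    simpa using h.subset_compl_left
  have heq : x • Aᶜ = A :=
    Set.eq_of_subset_of_ncard_le hsub (by rw [ncard_smul_set]; omega)
  refine compl_ne_smul hA x ?_
  rw [Set.smul_set_compl] at heq
  rw [← compl_inj_iff, compl_compl, heq]

theorem mem_selfLinkedHalves_of_translateOrCompl {A B : Set G}
    (hB : B ∈ selfLinkedHalves G) (h : TranslateOrCompl A B) : A ∈ selfLinkedHalves G := by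
  obtain ⟨x, rfl | h⟩ := h
  · exact smul_mem_selfLinkedHalves hB x
  · rw [← compl_compl A, h]
    exact compl_mem_selfLinkedHalves (smul_mem_selfLinkedHalves hB x)

theorem eq_compl_of_disjoint {X : Type*} [Finite X] {A B : Set X}
    (hA : Nat.card X ≤ 2 * A.ncard) (hB : Nat.card X ≤ 2 * B.ncard)
    (h : ¬ (A ∩ B).Nonempty) : B = Aᶜ := by
  rw [Set.not_nonempty_iff_eq_empty, ← Set.disjoint_iff_inter_eq_empty] at h
  have hc := Set.ncard_add_ncard_compl A
  exact Set.eq_of_subset_of_ncard_le h.subset_compl_left (by omega)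

theorem le_two_mul_ncard_of_linked {X : Type*} [Finite X] {L : Set (Set X)}
    (hL : Linked L) (h₀ : largeSets X ⊆ L) {A : Set X} (hA : A ∈ L) :
    Nat.card X ≤ 2 * A.ncard := by
  by_contra! h
  have hc := Set.ncard_add_ncard_compl A
  exact hL.compl_notMem hA (h₀ (show Nat.card X < 2 * Aᶜ.ncard by omega))

theorem mem_largeSets_or_mem_selfLinkedHalves {L : Set (Set G)} (hL : Linked L)
    (hinv : Invariant L) (h₀ : largeSets G ⊆ L) {A : Set G} (hA : A ∈ L) :
    A ∈ largeSets G ∨ A ∈ selfLinkedHalves G := by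
  rcases (le_two_mul_ncard_of_linked hL h₀ hA).lt_or_eq with h | h
  · exact Or.inl h
  · exact Or.inr ⟨fun x => hL A hA _ (hinv x A hA), h.symm⟩

theorem IsMaxInvLinked.mem_or_compl_mem {L : Set (Set G)} (hL : IsMaxInvLinked L)
    (h₀ : largeSets G ⊆ L) {A : Set G} (hA : A ∈ selfLinkedHalves G) :
    A ∈ L ∨ Aᶜ ∈ L := by
  obtain ⟨hlink, hinv, hmax⟩ := hL
  rw [or_iff_not_imp_right]
  intro hAc
  have key : ∀ B ∈ L, ∀ x : G, (B ∩ x • A).Nonempty := by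
    intro B hB x
    by_contra h
    have hx : Nat.card G ≤ 2 * (x • A).ncard := by rw [ncard_smul_set]; exact hA.2.ge
    have h' := eq_compl_of_disjoint (le_two_mul_ncard_of_linked hlink h₀ hB) hx h
    rw [← compl_inj_iff, compl_compl, ← Set.smul_set_compl] at h'
    exact hAc (hinv.smul_mem_iff.1 (h' ▸ hB))
  have hM : L ∪ Set.range (fun x : G => x • A) = L := by
    refine hmax _ ?_ ?_ Set.subset_union_left
    · rintro B (hB | ⟨x, rfl⟩) C (hC | ⟨y, rfl⟩)
      · exact hlink B hB C hC
      · exact key B hB y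
      · rw [Set.inter_comm]
        exact key C hC x
      · have h := (hA.1 (x⁻¹ * y)).smul_set (a := x)
        rwa [Set.smul_set_inter, smul_smul, mul_inv_cancel_left] at h
    · rintro x B (hB | ⟨y, rfl⟩)
      · exact Or.inl (hinv x B hB)
      · exact Or.inr ⟨x * y, mul_smul x y A⟩
  rw [← hM]
  exact Or.inr ⟨1, one_smul G A⟩

theorem isMaxInvLinked_of_mem_or_compl_mem {L : Set (Set G)} (hlink : Linked L)
    (hinv : Invariant L) (h₀ : largeSets G ⊆ L)
    (h : ∀ A ∈ selfLinkedHalves G, A ∈ L ∨ Aᶜ ∈ L) : IsMaxInvLinked L := by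
  refine ⟨hlink, hinv, fun M hM hMinv hLM => Set.Subset.antisymm (fun A hA => ?_) hLM⟩
  rcases mem_largeSets_or_mem_selfLinkedHalves hM hMinv (h₀.trans hLM) hA with hA' | hA'
  · exact h₀ hA'
  · exact (h A hA').resolve_right fun hc => hM.compl_notMem hA (hLM hc)

theorem IsMaxInvLinked.compl_mem_iff {L : Set (Set G)} (hL : IsMaxInvLinked L)
    (h₀ : largeSets G ⊆ L) {A : Set G} (hA : A ∈ selfLinkedHalves G) :
    Aᶜ ∈ L ↔ A ∉ L :=
  ⟨fun h h' => hL.1.compl_notMem h' h, (hL.mem_or_compl_mem h₀ hA).resolve_left⟩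

theorem systemOfChoice_isMaxInvLinked {R : Set (Set G)} (hR : R ⊆ selfLinkedHalves G)
    (hex : ∀ A ∈ selfLinkedHalves G, ∃ B ∈ R, TranslateOrCompl A B)
    (huniq : ∀ B ∈ R, ∀ C ∈ R, TranslateOrCompl B C → B = C) (P : Set (Set G)) :
    IsMaxInvLinked (systemOfChoice R P) := by
  have hsize : ∀ A ∈ systemOfChoice R P, Nat.card G ≤ 2 * A.ncard := by
    rintro A (hA | ⟨B, hB, x, h⟩)
    · exact le_of_lt hA
    · exact (mem_selfLinkedHalves_of_translateOrCompl (hR hB)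
        ⟨x, h.imp And.right And.right⟩).2.ge
  have hcompl : ∀ A ∈ systemOfChoice R P, Aᶜ ∉ systemOfChoice R P := by
    intro A hA hAc
    have hc := Set.ncard_add_ncard_compl A
    have h1 := hsize A hA
    have h2 := hsize _ hAc
    have hA : A ∉ largeSets G := fun h : Nat.card G < 2 * A.ncard => by omega
    have hA' : Aᶜ ∉ largeSets G := fun h : Nat.card G < 2 * Aᶜ.ncard => by omega
    obtain ⟨B, hB, x, hx⟩ := (‹A ∈ systemOfChoice R P›).resolve_left hA
    obtain ⟨C, hC, y, hy⟩ := hAc.resolve_left hA'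
    rw [compl_compl] at hy
    have hAB : TranslateOrCompl A B := ⟨x, hx.imp And.right And.right⟩
    have hAC : TranslateOrCompl A C := ⟨y, (hy.imp And.right And.right).symm⟩
    obtain rfl := huniq B hB C hC (hAB.symm.trans hAC)
    have hAS := mem_selfLinkedHalves_of_translateOrCompl (hR hB) hAB
    rcases hx with ⟨hP, hx⟩ | ⟨hP, hx⟩ <;> rcases hy with ⟨hP', hy⟩ | ⟨hP', hy⟩
    · exact compl_ne_smul hAS (y * x⁻¹) (by rw [hy, mul_smul, hx, inv_smul_smul])
    · exact hP' hP
    · exact hP hP'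
    · exact compl_ne_smul hAS (x * y⁻¹) (by rw [hx, mul_smul, hy, inv_smul_smul])
  refine isMaxInvLinked_of_mem_or_compl_mem ?_ ?_ Set.subset_union_left ?_
  · intro A hA B hB
    by_contra h
    exact hcompl A hA (eq_compl_of_disjoint (hsize A hA) (hsize B hB) h ▸ hB)
  · rintro y A (hA | ⟨B, hB, x, h⟩)
    · exact Or.inl (show Nat.card G < 2 * (y • A).ncard by rw [ncard_smul_set]; exact hA)
    · refine Or.inr ⟨B, hB, y * x, ?_⟩
      rwa [← Set.smul_set_compl, mul_smul, smul_left_cancel_iff, smul_left_cancel_iff]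
  · intro A hA
    obtain ⟨B, hB, x, h⟩ := hex A hA
    by_cases hP : B ∈ P
    · rcases h with h | h
      · exact Or.inl (Or.inr ⟨B, hB, x, Or.inl ⟨hP, h⟩⟩)
      · exact Or.inr (Or.inr ⟨B, hB, x, Or.inl ⟨hP, h⟩⟩)
    · rcases h with h | h
      · exact Or.inr (Or.inr ⟨B, hB, x, Or.inr ⟨hP, by rwa [compl_compl]⟩⟩)
      · exact Or.inl (Or.inr ⟨B, hB, x, Or.inr ⟨hP, h⟩⟩)

theorem IsMaxInvLinked.subset_of_inter_eq {R : Set (Set G)}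
    (hex : ∀ A ∈ selfLinkedHalves G, ∃ B ∈ R, TranslateOrCompl A B)
    {L M : Set (Set G)} (hL : IsMaxInvLinked L) (hL₀ : largeSets G ⊆ L)
    (hM : IsMaxInvLinked M) (hM₀ : largeSets G ⊆ M) (h : L ∩ R = M ∩ R) : L ⊆ M := by
  intro A hA
  rcases mem_largeSets_or_mem_selfLinkedHalves hL.1 hL.2.1 hL₀ hA with hA' | hA'
  · exact hM₀ hA'
  obtain ⟨B, hB, x, hx⟩ := hex A hA'
  have hLM : B ∈ L ↔ B ∈ M := by
    have := Set.ext_iff.1 h B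
    simpa [hB] using this
  rcases hx with rfl | hx
  · rw [hM.2.1.smul_mem_iff, ← hLM]
    exact hL.2.1.smul_mem_iff.1 hA
  · by_contra hAM
    rw [← hM.compl_mem_iff hM₀ hA', hx, hM.2.1.smul_mem_iff, ← hLM,
      ← hL.2.1.smul_mem_iff (x := x), ← hx] at hAM
    exact hL.1.compl_notMem hA hAM

theorem card_isMaxInvLinked_of_representatives {R : Set (Set G)}
    (hR : R ⊆ selfLinkedHalves G)
    (hex : ∀ A ∈ selfLinkedHalves G, ∃ B ∈ R, TranslateOrCompl A B)
    (huniq : ∀ B ∈ R, ∀ C ∈ R, TranslateOrCompl B C → B = C) :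
    Nat.card {L : Set (Set G) // IsMaxInvLinked L ∧ largeSets G ⊆ L} = 2 ^ R.ncard := by
  rw [← Set.ncard_powerset R, ← Nat.card_coe_set_eq]
  refine Nat.card_congr (Equiv.ofBijective
    (fun L => ⟨L.1 ∩ R, Set.inter_subset_right⟩) ⟨fun L M h => ?_, fun P => ?_⟩)
  · have h' : L.1 ∩ R = M.1 ∩ R := congrArg Subtype.val h
    exact Subtype.ext (Set.Subset.antisymm
      (L.2.1.subset_of_inter_eq hex L.2.2 M.2.1 M.2.2 h')
      (M.2.1.subset_of_inter_eq hex M.2.2 L.2.1 L.2.2 h'.symm))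
  · exact ⟨⟨systemOfChoice R P.1, systemOfChoice_isMaxInvLinked hR hex huniq P.1,
      Set.subset_union_left⟩, Subtype.ext (systemOfChoice_inter hR huniq P.2)⟩

end Translates

/-- A symmetric and transitive relation, reflexive on `S`, admits a set of representatives
in `S` that is equinumerous with the set of its classes. -/
theorem exists_representatives {α : Type*} (S : Set α) (r : α → α → Prop)
    (hrefl : ∀ a, r a a) (hsymm : ∀ {a b}, r a b → r b a)
    (htrans : ∀ {a b c}, r a b → r b c → r a c) :
    ∃ R ⊆ S, (∀ a ∈ S, ∃ b ∈ R, r a b) ∧ (∀ b ∈ R, ∀ c ∈ R, r b c → b = c) ∧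
      R.ncard = Set.ncard {T : Set α | ∃ a ∈ S, T = {b ∈ S | r a b}} := by
  have hch : ∀ T : {T : Set α | ∃ a ∈ S, T = {b ∈ S | r a b}},
      ∃ a ∈ S, T.1 = {b ∈ S | r a b} := fun T => T.2
  choose f hfS hf using hch
  refine ⟨Set.range f, Set.range_subset_iff.2 hfS, fun a ha => ?_, ?_, ?_⟩
  · refine ⟨f ⟨_, a, ha, rfl⟩, ⟨_, rfl⟩, ?_⟩
    have h := hf ⟨_, a, ha, rfl⟩
    have hmem : a ∈ {b ∈ S | r a b} := ⟨ha, hrefl a⟩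
    rw [show {b ∈ S | r a b} = _ from h] at hmem
    exact hsymm hmem.2
  · rintro _ ⟨T, rfl⟩ _ ⟨U, rfl⟩ h
    congr 1
    apply Subtype.ext
    rw [hf T, hf U]
    ext b
    exact and_congr_right fun _ => ⟨htrans (hsymm h), htrans h⟩
  · rw [← Set.image_univ, Set.ncard_image_of_injective _ fun T U h => ?_, Set.ncard_univ,
      Nat.card_coe_set_eq]
    apply Subtype.ext
    rw [hf T, hf U, h]

/-- Let `G` be a finite group of even order, `S` the family of self-linked subsets of `G`
of cardinality `|G|/2`, and `∼` the relation on `S` with `A ∼ B` iff `A = xB` or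
`G∖A = xB` for some `x ∈ G`. Then `∼` is an equivalence relation on `S`, the number of
maximal invariant linked systems containing `L₀ = {A : 2|A| > |G|}` is exactly `2^s`
where `s` is the number of `∼`-classes, and hence the number of maximal invariant linked
systems on `G` is at least `2^s`. -/
theorem stmt10 {G : Type*} [Group G] [Finite G] (heven : Even (Nat.card G))
    (S : Set (Set G))
    (hS : S = {A : Set G | (∀ x : G, (A ∩ x • A).Nonempty) ∧ 2 * A.ncard = Nat.card G})
    (r : Set G → Set G → Prop)
    (hr : ∀ A B : Set G, r A B ↔ ∃ x : G, A = x • B ∨ Set.univ \ A = x • B)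
    (s : ℕ)
    (hs : s = Set.ncard {T : Set (Set G) | ∃ A ∈ S, T = {B ∈ S | r A B}}) :
    (∀ A ∈ S, r A A) ∧
    (∀ A ∈ S, ∀ B ∈ S, r A B → r B A) ∧
    (∀ A ∈ S, ∀ B ∈ S, ∀ C ∈ S, r A B → r B C → r A C) ∧
    Nat.card {L : Set (Set G) //
        IsMaxInvLinked L ∧ {A : Set G | Nat.card G < 2 * A.ncard} ⊆ L} = 2 ^ s ∧
    2 ^ s ≤ Nat.card {L : Set (Set G) // IsMaxInvLinked L} := by
  obtain rfl : S = selfLinkedHalves G := hS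
  obtain rfl : r = TranslateOrCompl := by
    ext A B
    rw [hr, ← Set.compl_eq_univ_sdiff]
    rfl
  obtain ⟨R, hR, hex, huniq, hcard⟩ := exists_representatives (selfLinkedHalves G)
    TranslateOrCompl TranslateOrCompl.refl TranslateOrCompl.symm TranslateOrCompl.trans
  have hcount : Nat.card {L : Set (Set G) //
      IsMaxInvLinked L ∧ {A : Set G | Nat.card G < 2 * A.ncard} ⊆ L} = 2 ^ s := by
    rw [hs, ← hcard]
    exact card_isMaxInvLinked_of_representatives hR hex huniq
  refine ⟨fun A _ => .refl A, fun A _ B _ h => h.symm, fun A _ B _ C _ h h' => h.trans h',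
    hcount, ?_⟩
  rw [← hcount]
  exact Nat.card_le_card_of_injective (fun L => ⟨L.1, L.2.1⟩) fun L M h =>
    Subtype.ext (Subtype.mk.inj h)
end

section
/- The number of maximal invariant linked systems on the cyclic group C₇ of order 7 is exactly 3. -/
open Pointwise

/-- An antichain of invariant linked systems that dominates every invariant linked system
consists of exactly the maximal invariant linked systems. -/
theorem setOf_isMaxInvLinked_eq {X : Type*} [Group X] {S : Set (Set (Set X))}
    (hS : ∀ L ∈ S, Linked L ∧ Invariant L) (hanti : IsAntichain (· ⊆ ·) S)
    (hdom : ∀ L : Set (Set X), Linked L → Invariant L → ∃ M ∈ S, L ⊆ M) :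
    {L : Set (Set X) | IsMaxInvLinked L} = S := by
  ext L
  constructor
  · rintro ⟨hl, hi, hmax⟩
    obtain ⟨M, hM, hLM⟩ := hdom L hl hi
    rwa [← hmax M (hS M hM).1 (hS M hM).2 hLM]
  · intro hL
    refine ⟨(hS L hL).1, (hS L hL).2, fun M hl hi hLM => ?_⟩
    obtain ⟨N, hN, hMN⟩ := hdom M hl hi
    obtain rfl := hanti.eq hL hN (hLM.trans hMN)
    exact hMN.antisymm hLM

/-- The family of all subsets that meet every translate of `D`. -/
def transversals {X : Type*} [Group X] (D : Set X) : Set (Set X) :=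
  {A | ∀ x : X, (A ∩ x • D).Nonempty}

theorem invariant_transversals {X : Type*} [Group X] (D : Set X) :
    Invariant (transversals D) := by
  intro x A hA y
  obtain ⟨z, hzA, hzD⟩ := hA (x⁻¹ * y)
  refine ⟨x • z, Set.smul_mem_smul_set hzA, ?_⟩
  rwa [mul_smul, Set.mem_inv_smul_set_iff] at hzD

theorem linked_transversals {X : Type*} [Group X] {D : Set X}
    (hD : ∀ A ∈ transversals D, ∃ x : X, x • D ⊆ A) : Linked (transversals D) := by
  intro A hA B hB
  obtain ⟨x, hx⟩ := hD A hA
  exact (hB x).mono fun _ hz => ⟨hx hz.2, hz.1⟩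

theorem subset_transversals {X : Type*} [Group X] {L : Set (Set X)} (hl : Linked L)
    (hi : Invariant L) {x : X} {D : Set X} (hD : x • D ∈ L) : L ⊆ transversals D := by
  intro A hA y
  have h := hi (y * x⁻¹) _ hD
  rw [smul_smul, inv_mul_cancel_right] at h
  exact hl A hA _ h

theorem linked_setOf_card_lt_two_mul_ncard {X : Type*} [Finite X] :
    Linked {A : Set X | Nat.card X < 2 * A.ncard} := by
  intro A hA B hB
  by_contra h
  rw [Set.not_nonempty_iff_eq_empty, ← Set.disjoint_iff_inter_eq_empty] at h
  have hu := Set.ncard_union_eq h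
  have hle := Set.ncard_le_card (A ∪ B)
  simp only [Set.mem_ofPred_eq] at hA hB
  omega

theorem invariant_setOf_card_lt_two_mul_ncard {X : Type*} [Group X] :
    Invariant {A : Set X | Nat.card X < 2 * A.ncard} := by
  intro x A hA
  simpa only [Set.mem_ofPred_eq, Set.ncard_smul_set] using hA

/-- The quadratic residues modulo 7, a perfect difference set whose translates are the lines
of the Fano plane. -/
def quadraticResidues : Finset (Multiplicative (ZMod 7)) :=
  {.ofAdd 1, .ofAdd 2, .ofAdd 4}

/-- The quadratic nonresidues modulo 7. -/
def quadraticNonresidues : Finset (Multiplicative (ZMod 7)) :=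
  {.ofAdd 3, .ofAdd 5, .ofAdd 6}

theorem exists_smul_subset_of_transversal_finset :
    ∀ D ∈ ({quadraticResidues, quadraticNonresidues} : Finset _),
    ∀ A : Finset (Multiplicative (ZMod 7)),
      (∀ x : Multiplicative (ZMod 7), (A ∩ x • D).Nonempty) →
        ∃ x : Multiplicative (ZMod 7), x • D ⊆ A := by
  decide +kernel

theorem exists_eq_smul_of_self_linked_finset :
    ∀ A : Finset (Multiplicative (ZMod 7)), 2 * A.card ≤ 7 →
      (∀ x : Multiplicative (ZMod 7), (A ∩ x • A).Nonempty) →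
        ∃ D ∈ ({quadraticResidues, quadraticNonresidues} : Finset _),
          ∃ x : Multiplicative (ZMod 7), A = x • D := by
  decide +kernel

theorem exists_smul_subset_of_mem_transversals {D : Finset (Multiplicative (ZMod 7))}
    (hD : D ∈ ({quadraticResidues, quadraticNonresidues} : Finset _)) :
    ∀ A ∈ transversals (D : Set (Multiplicative (ZMod 7))),
      ∃ x : Multiplicative (ZMod 7), x • (D : Set (Multiplicative (ZMod 7))) ⊆ A := by
  intro A hA
  obtain ⟨A, rfl⟩ := A.toFinite.exists_finset_coe
  simp only [transversals, Set.mem_ofPred_eq] at hA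
  exact_mod_cast exists_smul_subset_of_transversal_finset D hD A (by exact_mod_cast hA)

theorem self_mem_transversals {D : Finset (Multiplicative (ZMod 7))}
    (hD : D ∈ ({quadraticResidues, quadraticNonresidues} : Finset _)) :
    (D : Set (Multiplicative (ZMod 7))) ∈ transversals (D : Set (Multiplicative (ZMod 7))) := by
  have h : ∀ D ∈ ({quadraticResidues, quadraticNonresidues} : Finset _),
      ∀ x : Multiplicative (ZMod 7), (D ∩ x • D).Nonempty := by decide +kernel
  intro x
  exact_mod_cast h D hD x

theorem notMem_transversals_of_disjoint {X : Type*} [Group X] {A D : Set X}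
    (h : Disjoint A D) : A ∉ transversals D := by
  intro hA
  have h1 := hA 1
  rw [one_smul] at h1
  exact Set.not_nonempty_iff_eq_empty.2 h.inter_eq h1

theorem ncard_eq_three_of_mem {D : Finset (Multiplicative (ZMod 7))}
    (hD : D ∈ ({quadraticResidues, quadraticNonresidues} : Finset _)) :
    (D : Set (Multiplicative (ZMod 7))).ncard = 3 := by
  have h : ∀ D ∈ ({quadraticResidues, quadraticNonresidues} : Finset _), D.card = 3 := by
    decide +kernel
  rw [Set.ncard_coe_finset, h D hD]

/-- The number of maximal invariant linked systems on the cyclic group `C₇` of order 7 is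
exactly 3. -/
theorem stmt11 :
    Nat.card {L : Set (Set (Multiplicative (ZMod 7))) // IsMaxInvLinked L} = 3 := by
  have hcard : Nat.card (Multiplicative (ZMod 7)) = 7 := by simp
  have hQ : quadraticResidues ∈
    ({quadraticResidues, quadraticNonresidues} : Finset _) := by simp
  have hN : quadraticNonresidues ∈
    ({quadraticResidues, quadraticNonresidues} : Finset _) := by simp
  have hdisj : Disjoint (quadraticResidues : Set (Multiplicative (ZMod 7)))
      quadraticNonresidues := by
    rw [Finset.disjoint_coe]
    decide
  set U : Set (Set (Multiplicative (ZMod 7))) :=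
    {A | Nat.card (Multiplicative (ZMod 7)) < 2 * A.ncard} with hU
  set T : Finset (Multiplicative (ZMod 7)) → Set (Set (Multiplicative (ZMod 7))) :=
    fun D => transversals (D : Set (Multiplicative (ZMod 7)))
  have hUT : ∀ D ∈ ({quadraticResidues, quadraticNonresidues} : Finset _), ¬ U ⊆ T D := by
    intro D hD h
    refine notMem_transversals_of_disjoint disjoint_compl_left (h (a := (D : Set _)ᶜ) ?_)
    have hc := Set.ncard_add_ncard_compl (D : Set (Multiplicative (ZMod 7)))
    rw [ncard_eq_three_of_mem hD] at hc
    simp only [hU, Set.mem_ofPred_eq]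
    omega
  have hTU : ∀ D ∈ ({quadraticResidues, quadraticNonresidues} : Finset _), ¬ T D ⊆ U := by
    intro D hD h
    have hc := h (self_mem_transversals hD)
    simp only [hU, Set.mem_ofPred_eq, ncard_eq_three_of_mem hD, hcard] at hc
    omega
  have hQN : ¬ T quadraticResidues ⊆ T quadraticNonresidues := fun h =>
    notMem_transversals_of_disjoint hdisj (h (self_mem_transversals hQ))
  have hNQ : ¬ T quadraticNonresidues ⊆ T quadraticResidues := fun h =>
    notMem_transversals_of_disjoint hdisj.symm (h (self_mem_transversals hN))
  have hmax : {L : Set (Set (Multiplicative (ZMod 7))) | IsMaxInvLinked L} =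
      {U, T quadraticResidues, T quadraticNonresidues} := by
    refine setOf_isMaxInvLinked_eq ?_ ?_ fun L hl hi => ?_
    · rintro L (rfl | rfl | rfl)
      · exact ⟨linked_setOf_card_lt_two_mul_ncard, invariant_setOf_card_lt_two_mul_ncard⟩
      · exact ⟨linked_transversals (exists_smul_subset_of_mem_transversals hQ),
          invariant_transversals _⟩
      · exact ⟨linked_transversals (exists_smul_subset_of_mem_transversals hN),
          invariant_transversals _⟩
    · rintro A (rfl | rfl | rfl) B (rfl | rfl | rfl) hne
      exacts [(hne rfl).elim, hUT _ hQ, hUT _ hN, hTU _ hQ, (hne rfl).elim, hQN, hTU _ hN, hNQ,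
        (hne rfl).elim]
    · by_cases hLU : L ⊆ U
      · exact ⟨U, by simp, hLU⟩
      obtain ⟨A, hA, hAU⟩ := Set.not_subset.1 hLU
      obtain ⟨A, rfl⟩ := A.toFinite.exists_finset_coe
      simp only [hU, Set.mem_ofPred_eq, not_lt, hcard, Set.ncard_coe_finset] at hAU
      obtain ⟨D, hD, x, rfl⟩ := exists_eq_smul_of_self_linked_finset A hAU fun x => by
        exact_mod_cast hl _ hA _ (hi x _ hA)
      rw [Finset.coe_smul_finset] at hA
      refine ⟨T D, ?_, subset_transversals hl hi hA⟩
      rw [Finset.mem_insert, Finset.mem_singleton] at hD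
      rcases hD with rfl | rfl <;> simp
  rw [← Set.coe_ofPred, Nat.card_coe_set_eq, hmax, Set.ncard_eq_three]
  exact ⟨_, _, _, fun h => hUT _ hQ h.subset, fun h => hUT _ hN h.subset,
    fun h => hQN h.subset, rfl⟩
end

section
/- For a group X the following are equivalent: (1) every element of X has odd (finite) order; (2) for every subset A ⊆ X, either A·A⁻¹ = X or (X∖A)·(X∖A)⁻¹ = X. -/
open Pointwise

lemma Set.exists_mul_mem_of_mul_inv_eq_univ {X : Type*} [Group X] {B : Set X}
    (h : B * B⁻¹ = Set.univ) (x : X) : ∃ b ∈ B, x * b ∈ B := by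
  have hx : x ∈ B * B⁻¹ := h ▸ Set.mem_univ x
  obtain ⟨a, ha, c, hc, rfl⟩ := Set.mem_mul.1 hx
  exact ⟨c⁻¹, hc, by simpa using ha⟩

lemma Set.exists_forall_mul_notMem_of_mul_inv_ne_univ {X : Type*} [Group X] {B : Set X}
    (h : B * B⁻¹ ≠ Set.univ) : ∃ x : X, ∀ b ∈ B, x * b ∉ B := by
  obtain ⟨x, hx⟩ := (Set.ne_univ_iff_exists_notMem _).1 h
  exact ⟨x, fun b hb hxb => hx (Set.mem_mul.2 ⟨x * b, hxb, b⁻¹, by simpa using hb, by group⟩)⟩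

/-- Left multiplication by an element whose order is even or infinite admits a proper
two-colouring of the group. -/
lemma exists_set_mul_mem_iff_notMem_of_not_odd_orderOf {X : Type*} [Group X] {x : X}
    (hx : ¬ Odd (orderOf x)) : ∃ A : Set X, ∀ g, x * g ∈ A ↔ g ∉ A := by
  let r : X → X := fun g => (Quotient.mk (QuotientGroup.rightRel (Subgroup.zpowers x)) g).out
  have hr (g : X) : ∃ k : ℤ, g = x ^ k * r g := by
    have h := Quotient.mk_out (s := QuotientGroup.rightRel (Subgroup.zpowers x)) g
    obtain ⟨k, hk⟩ := Subgroup.mem_zpowers_iff.1 (QuotientGroup.rightRel_apply.1 h)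
    exact ⟨k, by rw [hk]; simp [r]⟩
  have hrx (g : X) : r (x * g) = r g := by
    refine congrArg Quotient.out (Quotient.sound ?_)
    refine QuotientGroup.rightRel_apply.2 ?_
    simp
  have heven : (2 : ℤ) ∣ orderOf x := by
    exact_mod_cast (Nat.not_odd_iff_even.1 hx).two_dvd
  refine ⟨{g | ∃ k : ℤ, Even k ∧ g = x ^ k * r g}, fun g => ⟨?_, fun hg => ?_⟩⟩
  · rintro ⟨j, hj, hxg⟩ ⟨k, hk, hg⟩
    have hpow : x ^ j = x ^ (1 + k) := by
      apply mul_right_cancel (b := r g)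
      rw [zpow_one_add, mul_assoc, ← hg, hxg, hrx]
    have h2 := heven.trans (orderOf_dvd_sub_iff_zpow_eq_zpow.2 hpow)
    obtain ⟨a, rfl⟩ := hj
    obtain ⟨b, rfl⟩ := hk
    omega
  · obtain ⟨k, hk⟩ := hr g
    have hodd : Odd k := Int.not_even_iff_odd.1 fun he => hg ⟨k, he, hk⟩
    refine ⟨1 + k, odd_one.add_odd hodd, ?_⟩
    rw [hrx, zpow_one_add, mul_assoc, ← hk]

/-- A set mapped into itself by left multiplication by `z` of finite order is also mapped
into itself by `z⁻¹`. -/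
lemma IsOfFinOrder.mem_of_mul_mem {X : Type*} [Group X] {z : X} (hz : IsOfFinOrder z)
    {A : Set X} (hA : ∀ a ∈ A, z * a ∈ A) {a : X} (ha : z * a ∈ A) : a ∈ A := by
  have hpow (n : ℕ) : z ^ n * (z * a) ∈ A := by
    induction n with
    | zero => simpa using ha
    | succ n ih => simpa [pow_succ', mul_assoc] using hA _ ih
  have h := hpow (orderOf z - 1)
  rwa [← mul_assoc, ← pow_succ, Nat.sub_add_cancel hz.orderOf_pos, pow_orderOf_eq_one,
    one_mul] at h

lemma not_odd_orderOf_of_mul_mem_iff_notMem {X : Type*} [Group X] {x : X} {A : Set X}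
    (hA : ∀ g, x * g ∈ A ↔ g ∉ A) : ¬ Odd (orderOf x) := by
  have hpow (n : ℕ) : x ^ n ∈ A ↔ (Even n ↔ (1 : X) ∈ A) := by
    induction n with
    | zero => simp
    | succ n ih =>
      rw [pow_succ', hA, ih, Nat.even_add_one]
      tauto
  intro hodd
  have h := hpow (orderOf x)
  rw [pow_orderOf_eq_one] at h
  have hne := Nat.not_even_iff_odd.2 hodd
  tauto

/-- For a group `X`, every element of `X` has odd (finite) order if and only if for every
subset `A ⊆ X` either `A·A⁻¹ = X` or `(X∖A)·(X∖A)⁻¹ = X`. -/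
theorem stmt15 {X : Type*} [Group X] :
    (∀ x : X, Odd (orderOf x)) ↔
      (∀ A : Set X, A * A⁻¹ = Set.univ ∨
        (Set.univ \ A) * (Set.univ \ A)⁻¹ = Set.univ) := by
  constructor
  · intro hodd A
    by_contra! ⟨h₁, h₂⟩
    obtain ⟨x, hx⟩ := Set.exists_forall_mul_notMem_of_mul_inv_ne_univ h₁
    obtain ⟨y, hy⟩ := Set.exists_forall_mul_notMem_of_mul_inv_ne_univ h₂
    have hy' (g : X) (hg : g ∉ A) : y * g ∈ A := by
      simpa using hy g ⟨Set.mem_univ g, hg⟩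
    have hfin : IsOfFinOrder (y * x) := orderOf_pos_iff.1 (hodd _).pos
    refine not_odd_orderOf_of_mul_mem_iff_notMem (x := x) (A := A)
      (fun g => ⟨fun hxg hg => hx g hg hxg, fun hg => ?_⟩) (hodd x)
    by_contra hxg
    refine hg (hfin.mem_of_mul_mem (fun a ha => ?_) ?_)
    · rw [mul_assoc]
      exact hy' _ (hx a ha)
    · rw [mul_assoc]
      exact hy' _ hxg
  · intro h x
    by_contra hx
    obtain ⟨A, hA⟩ := exists_set_mul_mem_iff_notMem_of_not_odd_orderOf hx
    rcases h A with h | h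
    · obtain ⟨b, hb, hxb⟩ := Set.exists_mul_mem_of_mul_inv_eq_univ h x
      exact (hA b).1 hxb hb
    · obtain ⟨b, hb, hxb⟩ := Set.exists_mul_mem_of_mul_inv_eq_univ h x
      exact hxb.2 ((hA b).2 hb.2)
end

section
/- For a group X the following are equivalent: (1) some maximal invariant linked system on X is a maximal linked system; (2) every maximal invariant linked system on X is a maximal linked system; (3) every element of X has odd (finite) order. (Equivalently, the superextension λ(X) has a right zero if and only if every element of X has odd order.) -/
open Pointwise

theorem IsMaxInvLinked.mem_of_subset {X : Type*} [Group X] {L : Set (Set X)}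
    (hL : IsMaxInvLinked L) {A B : Set X} (hA : A ∈ L) (hAB : A ⊆ B) : B ∈ L := by
  obtain ⟨hlink, hinv, hmax⟩ := hL
  rw [← hmax {C | ∃ A ∈ L, A ⊆ C} ?_ ?_ fun C hC => ⟨C, hC, subset_rfl⟩]
  · exact ⟨A, hA, hAB⟩
  · rintro C ⟨P, hP, hPC⟩ D ⟨Q, hQ, hQD⟩
    exact (hlink P hP Q hQ).mono (Set.inter_subset_inter hPC hQD)
  · rintro x C ⟨P, hP, hPC⟩
    exact ⟨x • P, hinv x P hP, Set.smul_set_mono hPC⟩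

theorem IsMaxLinked.mem_of_subset {X : Type*} {L : Set (Set X)}
    (hL : IsMaxLinked L) {A B : Set X} (hA : A ∈ L) (hAB : A ⊆ B) : B ∈ L := by
  obtain ⟨hlink, hmax⟩ := hL
  rw [← hmax {C | ∃ A ∈ L, A ⊆ C} ?_ fun C hC => ⟨C, hC, subset_rfl⟩]
  · exact ⟨A, hA, hAB⟩
  · rintro C ⟨P, hP, hPC⟩ D ⟨Q, hQ, hQD⟩
    exact (hlink P hP Q hQ).mono (Set.inter_subset_inter hPC hQD)

/-- A set outside a maximal linked system is empty or has its complement in the system. -/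
theorem IsMaxLinked.compl_mem_or_eq_empty {X : Type*} {L : Set (Set X)}
    (hL : IsMaxLinked L) {A : Set X} (hA : A ∉ L) : Aᶜ ∈ L ∨ A = ∅ := by
  by_contra! hcon
  obtain ⟨hAc, hne⟩ := hcon
  have hmeet : ∀ B ∈ L, (B ∩ A).Nonempty := fun B hB => by
    by_contra hBA
    exact hAc (hL.mem_of_subset hB (Set.subset_compl_iff_disjoint_right.2
      (Set.disjoint_iff_inter_eq_empty.2 (Set.not_nonempty_iff_eq_empty.1 hBA))))
  refine hA ?_
  rw [← hL.2 (insert A L) ?_ (Set.subset_insert A L)]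
  · exact Set.mem_insert A L
  · rintro P (rfl | hP) Q (rfl | hQ)
    · rwa [Set.inter_self]
    · rw [Set.inter_comm]
      exact hmeet Q hQ
    · exact hmeet P hP
    · exact hL.1 P hP Q hQ

theorem IsMaxLinked.mem_or_compl_mem {X : Type*} [Nonempty X] {L : Set (Set X)}
    (hL : IsMaxLinked L) (A : Set X) : A ∈ L ∨ Aᶜ ∈ L := by
  by_contra! hcon
  have h₁ := (hL.compl_mem_or_eq_empty hcon.1).resolve_left hcon.2
  have h₂ := (hL.compl_mem_or_eq_empty hcon.2).resolve_left
    (by simpa using hcon.1)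
  rw [h₁, Set.compl_empty] at h₂
  exact Set.univ_nonempty.ne_empty h₂

theorem Linked.isMaxLinked_of_forall {X : Type*} {L : Set (Set X)} (hL : Linked L)
    (h : ∀ A, A ∈ L ∨ Aᶜ ∈ L) : IsMaxLinked L := by
  refine ⟨hL, fun M hM hLM => (Set.Subset.antisymm hLM fun A hA => ?_).symm⟩
  refine (h A).resolve_right fun hAc => ?_
  have := hM A hA Aᶜ (hLM hAc)
  rw [Set.inter_compl_self] at this
  exact Set.not_nonempty_empty this

/-- A set outside a maximal invariant linked system has its complement in the system
or is disjoint from one of its translates. -/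
theorem IsMaxInvLinked.compl_mem_or_exists_smul_subset_compl {X : Type*} [Group X]
    {L : Set (Set X)} (hL : IsMaxInvLinked L) {A : Set X} (hA : A ∉ L) :
    Aᶜ ∈ L ∨ ∃ x : X, x • A ⊆ Aᶜ := by
  by_contra! hcon
  obtain ⟨hAc, hself⟩ := hcon
  have hmeet : ∀ x : X, ∀ B : Set X, ¬ B ⊆ Aᶜ → (x • B ∩ x • A).Nonempty := fun x B hB => by
    rw [← Set.smul_set_inter, Set.smul_set_nonempty]
    rwa [Set.subset_compl_iff_disjoint_right, Set.not_disjoint_iff_nonempty_inter] at hB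
  have hL' : ∀ B ∈ L, ∀ x : X, (B ∩ x • A).Nonempty := fun B hB x => by
    have := hmeet x (x⁻¹ • B) fun h => hAc (hL.mem_of_subset (hL.2.1 _ B hB) h)
    rwa [smul_inv_smul] at this
  refine hA ?_
  rw [← hL.2.2 (L ∪ Set.range fun x : X => x • A) ?_ ?_ Set.subset_union_left]
  · exact Or.inr ⟨1, one_smul X A⟩
  · rintro P (hP | ⟨x, rfl⟩) Q (hQ | ⟨y, rfl⟩)
    · exact hL.1 P hP Q hQ
    · exact hL' P hP y
    · rw [Set.inter_comm]
      exact hL' Q hQ x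
    · have := hmeet y ((y⁻¹ * x) • A) (hself _)
      rwa [smul_smul, mul_inv_cancel_left] at this
  · rintro z P (hP | ⟨x, rfl⟩)
    · exact Or.inl (hL.2.1 z P hP)
    · exact Or.inr ⟨z * x, mul_smul z x A⟩

theorem smul_set_subset_iterate {X : Type*} [Group X] {z : X} {A : Set X} (h : z • A ⊆ A)
    (n : ℕ) : z ^ n • A ⊆ A := by
  induction n with
  | zero => simp
  | succ n ih =>
    rw [pow_succ, mul_smul]
    exact (Set.smul_set_mono h).trans ih

theorem smul_set_eq_of_subset {X : Type*} [Group X] {z : X} (hz : IsOfFinOrder z) {A : Set X}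
    (h : z • A ⊆ A) : z • A = A := by
  obtain ⟨n, hn, hzn⟩ := isOfFinOrder_iff_pow_eq_one.1 hz
  refine h.antisymm ?_
  have := Set.smul_set_mono (a := z) (smul_set_subset_iterate h (n - 1))
  rwa [smul_smul, ← pow_succ', Nat.sub_add_cancel hn, hzn, one_smul] at this

theorem not_odd_orderOf_of_smul_eq_compl {X : Type*} [Group X] {x : X} {A : Set X}
    (h : x • A = Aᶜ) : ¬ Odd (orderOf x) := by
  have hsq : x ^ 2 • A = A := by
    rw [pow_two, mul_smul, h, Set.smul_set_compl, h, compl_compl]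
  rintro ⟨k, hk⟩
  have hpow : ∀ n : ℕ, (x ^ 2) ^ n • A = A := fun n => by
    induction n with
    | zero => simp
    | succ n ih => rw [pow_succ, mul_smul, hsq, ih]
  have : x ^ orderOf x • A = Aᶜ := by
    rw [hk, pow_succ', pow_mul, mul_smul, hpow, h]
  rw [pow_orderOf_eq_one, one_smul] at this
  exact ne_compl_self this

theorem IsMaxInvLinked.isMaxLinked_of_odd_orderOf {X : Type*} [Group X]
    (hX : ∀ x : X, Odd (orderOf x)) {L : Set (Set X)} (hL : IsMaxInvLinked L) :
    IsMaxLinked L := by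
  refine hL.1.isMaxLinked_of_forall fun A => ?_
  by_contra! hcon
  obtain ⟨hA, hAc⟩ := hcon
  obtain ⟨x, hx⟩ := (hL.compl_mem_or_exists_smul_subset_compl hA).resolve_left hAc
  obtain ⟨y, hy⟩ := (hL.compl_mem_or_exists_smul_subset_compl hAc).resolve_left
    (by rwa [compl_compl])
  rw [compl_compl] at hy
  have hyx : (y * x) • A ⊆ A := by
    rw [mul_smul]
    exact (Set.smul_set_mono hx).trans hy
  have heq := smul_set_eq_of_subset (orderOf_pos_iff.1 (hX (y * x)).pos) hyx
  rw [mul_smul] at heq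
  refine not_odd_orderOf_of_smul_eq_compl (hx.antisymm ?_) (hX x)
  rw [← heq] at hy
  exact Set.smul_set_subset_smul_set_iff.1 (by rwa [heq] at hy ⊢)

theorem zpow_mem_zpowers_sq_iff {X : Type*} [Group X] {x : X} (hx : ¬ Odd (orderOf x)) (k : ℤ) :
    x ^ k ∈ Subgroup.zpowers (x ^ 2) ↔ Even k := by
  rw [Subgroup.mem_zpowers_iff]
  constructor
  · rintro ⟨m, hm⟩
    have h : x ^ (k - 2 * m) = 1 := by
      rw [zpow_sub, ← hm, zpow_mul, zpow_ofNat, mul_inv_cancel]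
    rw [← orderOf_dvd_iff_zpow_eq_one] at h
    rw [Nat.not_odd_iff_even, even_iff_two_dvd] at hx
    have := (Int.natCast_dvd_natCast.2 hx).trans h
    rw [Int.even_iff]
    omega
  · rintro ⟨m, rfl⟩
    exact ⟨m, by rw [← zpow_natCast, ← zpow_mul]; congr 1; push_cast; ring⟩

/-- An element of even or infinite order maps some set onto its complement. -/
theorem exists_smul_eq_compl {X : Type*} [Group X] {x : X} (hx : ¬ Odd (orderOf x)) :
    ∃ A : Set X, x • A = Aᶜ := by
  let s := QuotientGroup.rightRel (Subgroup.zpowers x)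
  let r : X → X := fun g => (Quotient.mk s g).out
  have hr : ∀ g, ∃ k : ℤ, x ^ k = g * (r g)⁻¹ := fun g =>
    Subgroup.mem_zpowers_iff.1 (QuotientGroup.rightRel_apply.1 (Quotient.mk_out (s := s) g))
  have hrx : ∀ g, r (x⁻¹ * g) = r g := fun g => by
    refine congrArg Quotient.out (Quotient.sound (s := s) (QuotientGroup.rightRel_apply.2 ?_))
    simp
  refine ⟨{g | g * (r g)⁻¹ ∈ Subgroup.zpowers (x ^ 2)}, ?_⟩
  ext g
  obtain ⟨k, hk⟩ := hr g
  have hk' : x⁻¹ * g * (r g)⁻¹ = x ^ (k - 1) := by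
    rw [mul_assoc, ← hk, zpow_sub_one, ← zpow_neg_one, ← zpow_add, ← zpow_add, add_comm]
  rw [Set.mem_smul_set_iff_inv_smul_mem, Set.mem_compl_iff, Set.mem_ofPred_eq, Set.mem_ofPred_eq,
    smul_eq_mul, hrx, hk', ← hk, zpow_mem_zpowers_sq_iff hx, zpow_mem_zpowers_sq_iff hx,
    Int.even_sub_one]

theorem IsMaxLinked.odd_orderOf {X : Type*} [Group X] {L : Set (Set X)} (hL : IsMaxLinked L)
    (hinv : Invariant L) (x : X) : Odd (orderOf x) := by
  by_contra hx
  obtain ⟨A, hA⟩ := exists_smul_eq_compl hx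
  have key : ∀ B : Set X, x • B = Bᶜ → B ∉ L := fun B hB hBL => by
    have := hL.1 B hBL _ (hinv x B hBL)
    rw [hB, Set.inter_compl_self] at this
    exact Set.not_nonempty_empty this
  exact (hL.mem_or_compl_mem A).elim (key A hA) (key Aᶜ (by rw [Set.smul_set_compl, hA]))

/-- For a group `X` the following are equivalent: (1) some maximal invariant linked system
on `X` is maximal linked; (2) every maximal invariant linked system on `X` is maximal
linked; (3) every element of `X` has odd (finite) order. Equivalently, the superextension
`λ(X)` has a right zero iff every element of `X` has odd order. -/
theorem stmt16 {X : Type*} [Group X] :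
    ((∃ L : Set (Set X), IsMaxInvLinked L ∧ IsMaxLinked L) ↔
      (∀ L : Set (Set X), IsMaxInvLinked L → IsMaxLinked L)) ∧
    ((∃ L : Set (Set X), IsMaxInvLinked L ∧ IsMaxLinked L) ↔
      (∀ x : X, Odd (orderOf x))) := by
  have odd_of_exists : (∃ L : Set (Set X), IsMaxInvLinked L ∧ IsMaxLinked L) →
      ∀ x : X, Odd (orderOf x) :=
    fun ⟨_, hL, hL'⟩ => hL'.odd_orderOf hL.2.1
  have exists_of_forall (h : ∀ L : Set (Set X), IsMaxInvLinked L → IsMaxLinked L) :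
      ∃ L : Set (Set X), IsMaxInvLinked L ∧ IsMaxLinked L :=
    (exists_isMaxInvLinked X).imp fun L hL => ⟨hL, h L hL⟩
  have forall_of_odd (h : ∀ x : X, Odd (orderOf x)) (L : Set (Set X)) (hL : IsMaxInvLinked L) :
      IsMaxLinked L :=
    hL.isMaxLinked_of_odd_orderOf h
  exact ⟨⟨fun h => forall_of_odd (odd_of_exists h), exists_of_forall⟩,
    ⟨odd_of_exists, fun h => exists_of_forall (forall_of_odd h)⟩⟩
end
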